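/- (Approximation of piecewise polynomials, dense regime) Let d ≥ 1, b ≥ 2 an integer, ℓ, k ∈ ℕ, 0 < ε < b^{−ℓ}, 1 ≤ q ≤ p ≤ ∞, and δ > 0 with δq ≥ dℓ (for q = ∞ this holds automatically and the conventions dℓ/q = 0 and max-norm of the coefficients apply). There exists a constant C > 0 depending only on p, q, d, k, b such that the following holds. Let f = Σ_{|γ|≤k, i∈I_ℓ} a_{i,γ} ρ_{ℓ,i}^γ with real coefficients a_{i,γ}. For any S, T, W₀, L₀ ∈ ℕ with S, T, W₀, L₀ ≥ 1, there exist W, L ∈ ℕ with W ≤ C·max{ b^{δ + dℓ/2 − dℓ/q}/(S√T), b^{(δ − dℓ/q)/T}, b^{ℓ/L₀}, W₀·2^{W₀} } and L ≤ C·( ⌈b^{−δ + dℓ/q}·S⌉·T + L₀ ), and g ∈ NN_{d,1}(W, L), such that ‖f − g‖_{L^p(Ω_{ℓ,ε})} ≤ C·( b^{−δ} + 4^{−W₀L₀} )·( Σ_{|γ|≤k, i∈I_ℓ} |a_{i,γ}|^q )^{1/q}. -/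

import Mathlib

open MeasureTheory ENNReal Finset

noncomputable section

/-- The ReLU activation function. -/
def relu (t : ℝ) : ℝ := max t 0

/-- `A` is an affine map `ℝ^n → ℝ^m`. -/
def IsAffineMap {n m : ℕ} (A : (Fin n → ℝ) → (Fin m → ℝ)) : Prop :=
  ∃ (M : Matrix (Fin m) (Fin n) ℝ) (c : Fin m → ℝ),
    ∀ x i, A x i = (∑ j, M i j * x j) + c i

/-- Auxiliary definition of the ReLU network class, by recursion on the number
of hidden layers. -/
def NNaux (k W : ℕ) : ℕ → (d : ℕ) → Set ((Fin d → ℝ) → (Fin k → ℝ))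
  | 0, _ => {g | IsAffineMap g}
  | (L + 1), d => {g | ∃ N : ℕ, 1 ≤ N ∧ N ≤ W ∧
      ∃ (A : (Fin d → ℝ) → (Fin N → ℝ)) (h : (Fin N → ℝ) → (Fin k → ℝ)),
        IsAffineMap A ∧ h ∈ NNaux k W L N ∧
        g = fun x => h (fun i => relu (A x i))}

/-- The class `NN_{d,k}(W,L)` of functions `ℝ^d → ℝ^k` computed by fully connected
ReLU networks with width at most `W` and `L` hidden layers. -/
def NN (d k W L : ℕ) : Set ((Fin d → ℝ) → (Fin k → ℝ)) := NNaux k W L d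


/-- The trimmed subcube `Ω_{i,ε}^ℓ` of the partition of `[0,1)^d` into `b^{dℓ}`
subcubes, where a strip of width `ε` is removed on the right of each coordinate
(except for the last subcube in each coordinate). -/
def trimmedCell (d b ℓ : ℕ) (ε : ℝ) (i : Fin d → ℕ) : Set (Fin d → ℝ) :=
  {x | ∀ j, if i j < b ^ ℓ - 1
      then (i j : ℝ) / (b : ℝ) ^ ℓ ≤ x j ∧ x j < ((i j : ℝ) + 1) / (b : ℝ) ^ ℓ - ε
      else 1 - ((b : ℝ) ^ ℓ)⁻¹ ≤ x j ∧ x j < 1}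

/-- The good region `Ω_{ℓ,ε}`, the union of all trimmed subcubes. -/
def goodRegion (d b ℓ : ℕ) (ε : ℝ) : Set (Fin d → ℝ) :=
  ⋃ i ∈ {i : Fin d → ℕ | ∀ j, i j < b ^ ℓ}, trimmedCell d b ℓ ε i

/-- The subcube `Ω_i^ℓ` of the partition of `[0,1)^d` into `b^{dℓ}` subcubes. -/
def baseCell (d b ℓ : ℕ) (i : Fin d → ℕ) : Set (Fin d → ℝ) :=
  {x | ∀ j, (i j : ℝ) / (b : ℝ) ^ ℓ ≤ x j ∧ x j < ((i j : ℝ) + 1) / (b : ℝ) ^ ℓ}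

open Classical in
/-- The basis function `ρ_{ℓ,i}^γ` of the space of piecewise polynomials of degree
at most `k` subordinate to the partition of `[0,1)^d` into `b^{dℓ}` subcubes. -/
def rho (d b ℓ : ℕ) (i γ : Fin d → ℕ) (x : Fin d → ℝ) : ℝ :=
  if x ∈ baseCell d b ℓ i then ∏ j, ((b : ℝ) ^ ℓ * x j - (i j : ℝ)) ^ (γ j) else 0

/-- The (finite) set of multi-indices `γ` with `|γ| ≤ k`. -/
def Γset (d k : ℕ) : Finset (Fin d → Fin (k + 1)) :=
  Finset.univ.filter fun γ => ∑ j, (γ j : ℕ) ≤ k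

/-- The piecewise polynomial with coefficients `a` in the basis `ρ_{ℓ,i}^γ`. -/
def ppoly (d b ℓ k : ℕ) (a : (Fin d → Fin (b ^ ℓ)) → (Fin d → Fin (k + 1)) → ℝ)
    (x : Fin d → ℝ) : ℝ :=
  ∑ i : Fin d → Fin (b ^ ℓ), ∑ γ ∈ Γset d k,
    a i γ * rho d b ℓ (fun j => (i j : ℕ)) (fun j => (γ j : ℕ)) x

open Classical in
/-- The `ℓ^q` norm of a finite family of coefficients, for `q ∈ [1,∞]`
(for `q = ∞` this is the maximum of the absolute values). -/
def coefNorm (q : ℝ≥0∞) {ι : Type*} [Fintype ι] (v : ι → ℝ) : ℝ :=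
  if q = ⊤ then ⨆ i, |v i| else (∑ i, |v i| ^ q.toReal) ^ (1 / q.toReal)

/-- The space of affine combinations of the functions in `B`. -/
def affSpan {X : Type} (B : Set (X → ℝ)) : Submodule ℝ (X → ℝ) :=
  Submodule.span ℝ (insert 1 B)

/-- `Computes W L B A` means that the functions in `A` are jointly computed from those in `B`
by a ReLU network of width at most `W` with `L` hidden layers. -/
def Computes {X : Type} (W : ℕ) : ℕ → Set (X → ℝ) → Set (X → ℝ) → Prop
  | 0, B, A => A ⊆ affSpan B
  | L + 1, B, A => ∃ N, 1 ≤ N ∧ N ≤ W ∧ ∃ u : Fin N → X → ℝ,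
      (∀ i, u i ∈ affSpan B) ∧ Computes W L (Set.range fun i x => relu (u i x)) A

section affine
variable {X : Type} {A B : Set (X → ℝ)}

lemma subset_affSpan : B ⊆ affSpan B :=
  (Set.subset_insert _ _).trans Submodule.subset_span

lemma mem_affSpan {f : X → ℝ} (h : f ∈ B) : f ∈ affSpan B := subset_affSpan h

lemma mem_affSpan_of_eq {f g : X → ℝ} (e : f = g) (h : g ∈ affSpan B) : f ∈ affSpan B := e ▸ h

lemma const_mem_affSpan (c : ℝ) : (fun _ => c) ∈ affSpan B := by
  have : (fun _ : X => c) = c • (1 : X → ℝ) := by ext; simp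
  rw [this]
  exact Submodule.smul_mem _ _ (Submodule.subset_span (Set.mem_insert _ _))

lemma affSpan_le (h : A ⊆ affSpan B) : affSpan A ≤ affSpan B :=
  Submodule.span_le.2 (Set.insert_subset (const_mem_affSpan 1) h)

lemma affSpan_mono (h : A ⊆ B) : affSpan A ≤ affSpan B :=
  affSpan_le (h.trans subset_affSpan)

lemma add_mem_affSpan {f g : X → ℝ} (hf : f ∈ affSpan B) (hg : g ∈ affSpan B) :
    (fun x => f x + g x) ∈ affSpan B := Submodule.add_mem _ hf hg

lemma sub_mem_affSpan {f g : X → ℝ} (hf : f ∈ affSpan B) (hg : g ∈ affSpan B) :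
    (fun x => f x - g x) ∈ affSpan B := Submodule.sub_mem _ hf hg

lemma mul_mem_affSpan {f : X → ℝ} (c : ℝ) (hf : f ∈ affSpan B) :
    (fun x => c * f x) ∈ affSpan B := Submodule.smul_mem _ c hf

lemma sum_mem_affSpan {ι : Type} (s : Finset ι) {f : ι → X → ℝ}
    (hf : ∀ i ∈ s, f i ∈ affSpan B) : (fun x => ∑ i ∈ s, f i x) ∈ affSpan B := by
  have : (fun x => ∑ i ∈ s, f i x) = ∑ i ∈ s, f i := by ext; simp
  rw [this]
  exact Submodule.sum_mem _ hf

lemma exists_of_mem_affSpan_range {n : ℕ} {f : Fin n → X → ℝ} {g : X → ℝ}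
    (hg : g ∈ affSpan (Set.range f)) :
    ∃ (m : Fin n → ℝ) (c : ℝ), ∀ x, g x = (∑ j, m j * f j x) + c := by
  rw [affSpan, Submodule.mem_span_insert] at hg
  obtain ⟨c, z, hz, rfl⟩ := hg
  obtain ⟨m, rfl⟩ := (Submodule.mem_span_range_iff_exists_fun ℝ).1 hz
  exact ⟨m, c, fun x => by simp [add_comm]⟩

end affine

lemma eq_relu_sub_relu_neg {X : Type} (f : X → ℝ) : f = fun x => relu (f x) - relu (-f x) := by
  ext x
  simp only [relu]
  rcases le_total (f x) 0 with h | h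
  · rw [max_eq_right h, max_eq_left (by linarith)]; ring
  · rw [max_eq_left h, max_eq_right (by linarith)]; ring

namespace Computes
variable {X : Type} {A A' B B' C : Set (X → ℝ)} {W W' L L' : ℕ}

lemma mono_left (h : Computes W L B A) (hB : B ⊆ affSpan B') : Computes W L B' A := by
  cases L with
  | zero => exact h.trans (affSpan_le hB)
  | succ L =>
    obtain ⟨N, h1, h2, u, hu, h⟩ := h
    exact ⟨N, h1, h2, u, fun i => affSpan_le hB (hu i), h⟩

lemma mono_right (h : Computes W L B A) (hA : A' ⊆ affSpan A) : Computes W L B A' := by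
  induction L generalizing B with
  | zero => exact hA.trans (affSpan_le h)
  | succ L ih =>
    obtain ⟨N, h1, h2, u, hu, h⟩ := h
    exact ⟨N, h1, h2, u, hu, ih h⟩

lemma mono_width (h : Computes W L B A) (hW : W ≤ W') : Computes W' L B A := by
  induction L generalizing B with
  | zero => exact h
  | succ L ih =>
    obtain ⟨N, h1, h2, u, hu, h⟩ := h
    exact ⟨N, h1, h2.trans hW, u, hu, ih h⟩

lemma trans (h : Computes W L B A) (h' : Computes W L' A C) : Computes W (L + L') B C := by
  induction L generalizing B with
  | zero => rw [Nat.zero_add]; exact h'.mono_left h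
  | succ L ih =>
    obtain ⟨N, h1, h2, u, hu, h⟩ := h
    rw [Nat.add_right_comm]
    exact ⟨N, h1, h2, u, hu, ih h⟩

lemma union (h : Computes W L B A) (h' : Computes W' L B' A') :
    Computes (W + W') L (B ∪ B') (A ∪ A') := by
  induction L generalizing B B' with
  | zero =>
    exact Set.union_subset (Set.Subset.trans h (affSpan_mono Set.subset_union_left))
      (Set.Subset.trans h' (affSpan_mono Set.subset_union_right))
  | succ L ih =>
    obtain ⟨N, h1, h2, u, hu, h⟩ := h
    obtain ⟨N', h1', h2', u', hu', h'⟩ := h'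
    refine ⟨N + N', by omega, by omega, Fin.append u u', ?_, (ih h h').mono_left ?_⟩
    · intro i
      refine Fin.addCases (fun i => ?_) (fun i => ?_) i
      · rw [Fin.append_left]; exact affSpan_mono Set.subset_union_left (hu i)
      · rw [Fin.append_right]; exact affSpan_mono Set.subset_union_right (hu' i)
    · rintro _ (⟨i, rfl⟩ | ⟨i, rfl⟩)
      · exact mem_affSpan ⟨Fin.castAdd N' i, by simp⟩
      · exact mem_affSpan ⟨Fin.natAdd N i, by simp⟩

lemma union_same (h : Computes W L B A) (h' : Computes W' L B A') :
    Computes (W + W') L B (A ∪ A') := by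
  simpa using h.union h'

lemma layer {ι : Type} [Fintype ι] [Nonempty ι] (u : ι → X → ℝ) (hu : ∀ i, u i ∈ affSpan B)
    (hA : A ⊆ affSpan (Set.range fun i x => relu (u i x))) :
    Computes (Fintype.card ι) 1 B A := by
  let e := (Fintype.equivFin ι).symm
  refine ⟨Fintype.card ι, Fintype.card_pos, le_rfl, fun i => u (e i), fun i => hu _, ?_⟩
  refine hA.trans (affSpan_mono ?_)
  rintro _ ⟨i, rfl⟩
  exact ⟨e.symm i, by simp⟩

lemma carry (f : X → ℝ) (L : ℕ) : Computes 2 L {f} {f} := by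
  induction L with
  | zero => exact subset_affSpan
  | succ L ih =>
    have h : Computes 2 1 {f} {f} := by
      refine layer (ι := Fin 2) ![f, fun x => -f x] ?_ ?_
      · intro i
        fin_cases i
        · exact mem_affSpan rfl
        · exact Submodule.neg_mem _ (mem_affSpan rfl)
      · refine Set.singleton_subset_iff.2 ?_
        refine (congrArg (· ∈ affSpan _) (eq_relu_sub_relu_neg f)).mpr ?_
        exact sub_mem_affSpan (mem_affSpan ⟨0, by simp⟩) (mem_affSpan ⟨1, by simp⟩)
    rw [Nat.add_comm]
    exact h.trans ih

lemma iUnion {ι : Type} [Fintype ι] [Nonempty ι] {B A : ι → Set (X → ℝ)}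
    (h : ∀ i, Computes W L (B i) (A i)) :
    Computes (Fintype.card ι * W) L (⋃ i, B i) (⋃ i, A i) := by
  classical
  have key : ∀ s : Finset ι, s.Nonempty →
      Computes (#s * W) L (⋃ i ∈ s, B i) (⋃ i ∈ s, A i) := by
    intro s hs
    induction hs using Finset.Nonempty.cons_induction with
    | singleton i => simpa using h i
    | cons i s hi hs ih =>
      rw [Finset.card_cons, add_mul, one_mul, add_comm]
      simpa using (h i).union ih
  simpa using key Finset.univ Finset.univ_nonempty

lemma iUnion_same {ι : Type} [Fintype ι] [Nonempty ι] {A : ι → Set (X → ℝ)}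
    (h : ∀ i, Computes W L B (A i)) :
    Computes (Fintype.card ι * W) L B (⋃ i, A i) := by
  simpa [Set.iUnion_const] using iUnion h

lemma carry_range {ι : Type} [Fintype ι] [Nonempty ι] (f : ι → X → ℝ) (L : ℕ) :
    Computes (Fintype.card ι * 2) L (Set.range f) (Set.range f) := by
  simpa [Set.iUnion_singleton_eq_range] using iUnion fun i => carry (f i) L

lemma exists_mem_NNaux {k d : ℕ} {inp : Fin d → X → ℝ} {F : Fin k → X → ℝ}
    (h : Computes W L (Set.range inp) (Set.range F)) :
    ∃ g ∈ NNaux k W L d, ∀ x i, F i x = g (fun j => inp j x) i := by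
  induction L generalizing d with
  | zero =>
    choose m c hm using fun i => exists_of_mem_affSpan_range (h ⟨i, rfl⟩ : F i ∈ _)
    exact ⟨fun y i => (∑ j, m i j * y j) + c i, ⟨m, c, fun _ _ => rfl⟩, fun x i => hm i x⟩
  | succ L ih =>
    obtain ⟨N, h1, h2, u, hu, h⟩ := h
    obtain ⟨g, hg, hgF⟩ := ih h
    choose m c hm using fun i => exists_of_mem_affSpan_range (hu i)
    refine ⟨_, ⟨N, h1, h2, fun y i => (∑ j, m i j * y j) + c i, g, ⟨m, c, fun _ _ => rfl⟩,
      hg, rfl⟩, fun x i => ?_⟩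
    simp only [hgF, hm]

end Computes

/-- The function clamping a real number to `[0,1]`, as a combination of two ReLU units. -/
def clamp01 (t : ℝ) : ℝ := relu t - relu (t - 1)

lemma clamp01_of_nonpos {t : ℝ} (h : t ≤ 0) : clamp01 t = 0 := by
  simp [clamp01, relu, max_eq_right h, max_eq_right (show t - 1 ≤ 0 by linarith)]

lemma clamp01_of_one_le {t : ℝ} (h : 1 ≤ t) : clamp01 t = 1 := by
  simp [clamp01, relu, max_eq_left (show 0 ≤ t by linarith), max_eq_left (show 0 ≤ t - 1 by linarith)]

lemma clamp01_of_mem {t : ℝ} (h0 : 0 ≤ t) (h1 : t ≤ 1) : clamp01 t = t := by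
  simp [clamp01, relu, max_eq_left h0, max_eq_right (show t - 1 ≤ 0 by linarith)]

/-- On integers, `clamp01 (n - m + 1)` is the indicator of `m ≤ n`. -/
lemma clamp01_int (n m : ℤ) : clamp01 ((n : ℝ) - m + 1) = if m ≤ n then 1 else 0 := by
  split_ifs with h
  · have : (m : ℝ) ≤ n := by exact_mod_cast h
    exact clamp01_of_one_le (by linarith)
  · have : (n : ℝ) + 1 ≤ m := by exact_mod_cast (not_le.1 h)
    exact clamp01_of_nonpos (by linarith)

lemma clamp01_nat (n m : ℕ) : clamp01 ((n : ℝ) - m + 1) = if m ≤ n then 1 else 0 := by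
  simpa using clamp01_int n m

lemma Computes.clamps {X ι : Type} [Fintype ι] [Nonempty ι] {B : Set (X → ℝ)} (u : ι → X → ℝ)
    (hu : ∀ i, u i ∈ affSpan B) :
    Computes (Fintype.card ι * 2) 1 B (Set.range fun i x => clamp01 (u i x)) := by
  have h := Computes.layer (ι := ι × Fin 2) (B := B)
    (A := Set.range fun i x => clamp01 (u i x))
    (fun i x => if i.2 = 0 then u i.1 x else u i.1 x - 1) ?_ ?_
  · simpa using h
  · rintro ⟨i, e⟩
    by_cases he : e = 0
    · simpa [he] using hu i
    · simpa [he] using sub_mem_affSpan (hu i) (const_mem_affSpan 1)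
  · rintro _ ⟨i, rfl⟩
    exact sub_mem_affSpan (mem_affSpan ⟨(i, 0), by simp⟩) (mem_affSpan ⟨(i, 1), by simp⟩)

lemma Computes.relus {X ι : Type} [Fintype ι] [Nonempty ι] {B : Set (X → ℝ)} (u : ι → X → ℝ)
    (hu : ∀ i, u i ∈ affSpan B) :
    Computes (Fintype.card ι) 1 B (Set.range fun i x => relu (u i x)) :=
  Computes.layer u hu subset_affSpan

lemma Computes.relu_single {X : Type} {B : Set (X → ℝ)} {u : X → ℝ} (hu : u ∈ affSpan B) :
    Computes 1 1 B {fun x => relu (u x)} := by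
  simpa using Computes.relus (fun _ : Unit => u) fun _ => hu

lemma Computes.clamp_single {X : Type} {B : Set (X → ℝ)} {u : X → ℝ} (hu : u ∈ affSpan B) :
    Computes 2 1 B {fun x => clamp01 (u x)} := by
  simpa using Computes.clamps (fun _ : Unit => u) fun _ => hu

/-- Carrying a function which is an affine combination of the available ones. -/
lemma Computes.keep {X : Type} {B : Set (X → ℝ)} {u : X → ℝ} (hu : u ∈ affSpan B) (L : ℕ) :
    Computes 2 L B {u} :=
  (Computes.carry u L).mono_left (Set.singleton_subset_iff.2 hu)

lemma clamp01_margin {z η : ℝ} {n m : ℕ} (hη : 0 < η) (hz : (n : ℝ) ≤ z) (hz' : z ≤ n + 1 - η) :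
    clamp01 (η⁻¹ * (z - (m - η))) = if m ≤ n then 1 else 0 := by
  split_ifs with h
  · have : (m : ℝ) ≤ n := by exact_mod_cast h
    refine clamp01_of_one_le ?_
    rw [← div_eq_inv_mul, le_div_iff₀ hη]
    linarith
  · have : (n : ℝ) + 1 ≤ m := by exact_mod_cast (not_le.1 h)
    refine clamp01_of_nonpos (mul_nonpos_of_nonneg_of_nonpos (inv_nonneg.2 hη.le) ?_)
    linarith

lemma Nat.div_eq_sum_indicator {n A M : ℕ} (hM : 0 < M) (h : n < A * M) :
    ((n / M : ℕ) : ℝ) = ∑ m : Fin A, if ((m : ℕ) + 1) * M ≤ n then (1 : ℝ) else 0 := by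
  rw [Fin.sum_univ_eq_sum_range (fun m => if (m + 1) * M ≤ n then (1 : ℝ) else 0) A,
    Finset.sum_boole]
  congr 1
  have : Finset.filter (fun m => (m + 1) * M ≤ n) (range A) = range (n / M) := by
    ext m
    have h2 : n / M < A := (Nat.div_lt_iff_lt_mul hM).2 h
    simp only [Finset.mem_filter, Finset.mem_range, ← Nat.le_div_iff_mul_le hM]
    omega
  rw [this, Finset.card_range]

namespace Computes
variable {X : Type} {A B C : Set (X → ℝ)} {W W' L L' : ℕ}

/-- Extraction of the leading base-`A` digit of a number known up to a margin `η`. -/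
lemma digit {z : X → ℝ} {n : X → ℕ} {η : ℝ} {A M : ℕ} (hη : 0 < η) (hA : 1 ≤ A) (hM : 0 < M)
    (hz : ∀ x, (n x : ℝ) ≤ z x) (hz' : ∀ x, z x ≤ n x + 1 - η) (hn : ∀ x, n x < A * M) :
    Computes (A * 2) 1 {z} {fun x => ((n x / M : ℕ) : ℝ)} := by
  have : Nonempty (Fin A) := ⟨⟨0, hA⟩⟩
  have h := clamps (B := {z}) (fun (m : Fin A) x => η⁻¹ * (z x - (((m + 1) * M : ℕ) - η))) ?_
  · rw [Fintype.card_fin] at h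
    refine h.mono_right (Set.singleton_subset_iff.2 ?_)
    have e : (fun x => ((n x / M : ℕ) : ℝ)) = fun x => ∑ m : Fin A,
        clamp01 (η⁻¹ * (z x - (((m + 1) * M : ℕ) - η))) := by
      ext x
      rw [Nat.div_eq_sum_indicator hM (hn x)]
      exact Finset.sum_congr rfl fun m _ => (clamp01_margin hη (hz x) (hz' x)).symm
    rw [e]
    exact sum_mem_affSpan _ fun m _ => mem_affSpan ⟨m, rfl⟩
  · intro m
    exact mul_mem_affSpan _ (sub_mem_affSpan (mem_affSpan rfl) (const_mem_affSpan _))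

/-- The fractional part of a number is obtained by extracting all its digits. -/
lemma sub_floor {A : ℕ} (hA : 1 ≤ A) {η : ℝ} (hη : 0 < η) (t : ℕ) : ∀ {z : X → ℝ} {n : X → ℕ},
    (∀ x, (n x : ℝ) ≤ z x) → (∀ x, z x ≤ n x + 1 - η) → (∀ x, n x < A ^ t) →
    Computes (A * 2 + 2) t {z} {fun x => z x - n x} := by
  induction t with
  | zero =>
    intro z n _ _ hn
    have : (fun x => z x - n x) = z := by
      ext x
      have := hn x
      have : n x = 0 := by simpa using this
      simp [this]
    rw [this]
    exact subset_affSpan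
  | succ t ih =>
    intro z n hz hz' hn
    have hM : 0 < A ^ t := pow_pos hA t
    have h1 := (digit hη hA hM hz hz' (fun x => by rw [← pow_succ']; exact hn x)).union_same
      (carry z 1)
    have hd : ∀ x, (n x : ℝ) = (A ^ t : ℕ) * (n x / A ^ t : ℕ) + (n x % A ^ t : ℕ) := fun x => by
      exact_mod_cast (Nat.div_add_mod _ _).symm
    have h2 := ih (z := fun x => z x - (A ^ t : ℕ) * (n x / A ^ t : ℕ)) (n := fun x => n x % A ^ t)
      (fun x => by linarith [hz x, hd x]) (fun x => by linarith [hz' x, hd x])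
      (fun x => Nat.mod_lt _ hM)
    rw [add_comm t 1]
    refine h1.trans ((h2.mono_left ?_).mono_right ?_)
    · exact Set.singleton_subset_iff.2 (sub_mem_affSpan (mem_affSpan (by simp))
        (mul_mem_affSpan _ (mem_affSpan (by simp))))
    · refine Set.singleton_subset_iff.2 (mem_affSpan ?_)
      rw [Set.mem_singleton_iff]
      ext x
      linarith [hd x]

/-- The cell index of a point `x` of the good region in one coordinate. -/
lemma floor_of_good {V L₀ m : ℕ} (hV : 2 ≤ V) (hmV : m ≤ V ^ L₀) {η : ℝ} (hη : 0 < η)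
    (hη1 : η ≤ 1) {y : X → ℝ} {i : X → ℕ} (hi : ∀ x, i x < m)
    (h1 : ∀ x, (i x : ℝ) ≤ m * y x)
    (h2 : ∀ x, i x + 1 < m → m * y x ≤ i x + 1 - η) :
    Computes (V * 2 + 6) (1 + L₀) {y} {y, fun x => (i x : ℝ)} := by
  let z : X → ℝ := fun x => m * y x - relu (m * y x - (m - 1))
  have hu : (fun x => m * y x - (m - 1)) ∈ affSpan ({y} : Set (X → ℝ)) :=
    sub_mem_affSpan (mul_mem_affSpan _ (mem_affSpan rfl)) (const_mem_affSpan _)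
  have hz := (relu_single hu).union_same (carry y 1)
  have hz1 : ∀ x, (i x : ℝ) ≤ z x := by
    intro x
    have : (i x : ℝ) + 1 ≤ m := by exact_mod_cast hi x
    simp only [z, relu]
    rcases le_total (m * y x - (m - 1)) 0 with h | h
    · rw [max_eq_right h]; linarith [h1 x]
    · rw [max_eq_left h]; linarith
  have hz2 : ∀ x, z x ≤ i x + 1 - η := by
    intro x
    by_cases h : i x + 1 < m
    · have := h2 x h
      have h' : (i x : ℝ) + 1 ≤ m - 1 := by
        have : (i x : ℝ) + 1 + 1 ≤ m := by exact_mod_cast h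
        linarith
      simp only [z, relu]
      have := le_max_right (m * y x - (m - 1)) 0
      linarith
    · have : (m : ℝ) = i x + 1 := by
        have := hi x
        exact_mod_cast (by omega : m = i x + 1)
      simp only [z, relu]
      have := le_max_left (m * y x - (m - 1)) 0
      linarith
  have h3 := ((sub_floor (by omega : 1 ≤ V) hη L₀ hz1 hz2
    (fun x => (hi x).trans_le hmV)).union_same (carry z L₀)).union (carry y L₀)
  refine (hz.mono_width (by omega)).trans ((h3.mono_left ?_).mono_right ?_)
  · rintro _ (rfl | rfl)
    · exact sub_mem_affSpan (mul_mem_affSpan _ (mem_affSpan (by simp))) (mem_affSpan (by simp))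
    · exact mem_affSpan (by simp)
  · rintro _ (rfl | rfl)
    · exact mem_affSpan (by simp)
    · have e : (fun x => (i x : ℝ)) = fun x => z x - (z x - i x) := by
        ext x; ring
      rw [e]
      exact sub_mem_affSpan (mem_affSpan (by simp)) (mem_affSpan (by simp))

end Computes

namespace Computes
variable {X : Type} {A B C : Set (X → ℝ)} {W W' L L' : ℕ}

/-- Table lookup in a block of `V * V` consecutive entries. -/
lemma lookup_block {n J : X → ℕ} {s : ℕ → ℕ} (hs : ∀ x m, s m ≤ n x ↔ m ≤ J x)
    {y : ℕ → ℝ} {K : ℝ} (hy0 : ∀ m, 0 ≤ y m) (hyK : ∀ m, y m ≤ K) {V : ℕ} (hV : 1 ≤ V) (m₀ : ℕ) :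
    Computes (V * 4 + 4) 3 {fun x => (n x : ℝ)}
      {fun x => if m₀ ≤ J x ∧ J x < m₀ + V * V then y (J x) else 0} := by
  have : Nonempty (Fin V) := ⟨⟨0, hV⟩⟩
  let o : ℕ → X → ℝ := fun u x => if m₀ + u * V ≤ J x ∧ J x < m₀ + (u + 1) * V then 1 else 0
  have ho : ∀ u x, o u x = if m₀ ≤ J x ∧ u = (J x - m₀) / V then 1 else 0 := by
    intro u x
    have : (m₀ + u * V ≤ J x ∧ J x < m₀ + (u + 1) * V) ↔ (m₀ ≤ J x ∧ u = (J x - m₀) / V) := by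
      rw [eq_comm, Nat.div_eq_iff hV, Nat.mul_comm u V, Nat.add_mul, Nat.mul_comm u V]
      omega
    simp only [o, this]
  have hsum : ∀ x (f : ℕ → ℝ), ∑ u : Fin V, f u * o u x =
      if m₀ ≤ J x ∧ J x < m₀ + V * V then f ((J x - m₀) / V) else 0 := by
    intro x f
    rw [Fin.sum_univ_eq_sum_range (fun u => f u * o u x) V]
    have h2 : (J x - m₀) / V < V ↔ J x - m₀ < V * V := Nat.div_lt_iff_lt_mul hV
    by_cases h : m₀ ≤ J x
    · simp only [ho, h, true_and, mul_ite, mul_one, mul_zero, Finset.sum_ite_eq', Finset.mem_range,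
        h2]
      congr 1
      exact propext (by omega)
    · simp [ho, h]
  have hn : (fun x => (n x : ℝ)) ∈ affSpan {fun x => (n x : ℝ)} := mem_affSpan rfl
  -- first layer: the position in the coarse grid
  have s1 := (clamps (B := {fun x => (n x : ℝ)})
    (fun (u : Fin (V + 1)) x => (n x : ℝ) - (s (m₀ + u * V) : ℕ) + 1)
    (fun u => add_mem_affSpan (sub_mem_affSpan hn (const_mem_affSpan _))
      (const_mem_affSpan _))).union_same (carry _ 1)
  have s1' := s1.mono_right (A' := (Set.range fun (u : Fin V) x => o u x) ∪ {fun x => (n x : ℝ)}) ?_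
  swap
  · rintro _ (⟨u, rfl⟩ | rfl)
    · have e : (fun x => o u x) = fun x => clamp01 ((n x : ℝ) - (s (m₀ + u * V) : ℕ) + 1) -
          clamp01 ((n x : ℝ) - (s (m₀ + (u + 1) * V) : ℕ) + 1) := by
        ext x
        rw [clamp01_nat, clamp01_nat]
        simp only [hs, o]
        have : m₀ + u * V ≤ m₀ + (u + 1) * V := by gcongr; omega
        split_ifs <;> first | omega | norm_num
      refine mem_affSpan_of_eq e ?_
      exact sub_mem_affSpan (mem_affSpan (Or.inl ⟨u.castSucc, by simp⟩))
        (mem_affSpan (Or.inl ⟨u.succ, by simp⟩))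
    · exact mem_affSpan (Or.inr rfl)
  -- second layer: the position in the fine grid
  let w : ℕ → X → ℝ := fun v x =>
    if (m₀ ≤ J x ∧ J x < m₀ + V * V) ∧ v = (J x - m₀) % V then 1 else 0
  have hB : ∀ f : ℕ → ℝ, (fun x => ∑ u : Fin V, f u * o u x) ∈
      affSpan (Set.range fun (u : Fin V) x => o u x) := fun f =>
    sum_mem_affSpan _ fun u _ => mul_mem_affSpan _ (mem_affSpan ⟨u, rfl⟩)
  have s2 := (clamps (B := (Set.range fun (u : Fin V) x => o u x) ∪ {fun x => (n x : ℝ)})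
    (fun (v : Fin (V + 1)) x =>
      (n x : ℝ) - (∑ u : Fin V, (s (m₀ + u * V + v) : ℝ) * o u x) + 1)
    (fun v => add_mem_affSpan (sub_mem_affSpan (mem_affSpan (Or.inr rfl))
      (affSpan_mono Set.subset_union_left (hB fun u => (s (m₀ + u * V + v) : ℝ))))
      (const_mem_affSpan _))).union_same
      ((carry_range (fun (u : Fin V) x => o u x) 1).mono_left
        (Set.subset_union_left.trans subset_affSpan))
  have s2' := s2.mono_right (A' := (Set.range fun (v : Fin V) x => w v x) ∪
    (Set.range fun (u : Fin V) x => o u x)) ?_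
  swap
  · rintro _ (⟨v, rfl⟩ | ⟨u, rfl⟩)
    · have e : (fun x => w v x) = fun x =>
          clamp01 ((n x : ℝ) - (∑ u : Fin V, (s (m₀ + u * V + v) : ℝ) * o u x) + 1) -
          clamp01 ((n x : ℝ) - (∑ u : Fin V, (s (m₀ + u * V + (v + 1 : ℕ)) : ℝ) * o u x) + 1) := by
        ext x
        rw [hsum x fun u => (s (m₀ + u * V + v) : ℝ),
          hsum x fun u => (s (m₀ + u * V + (v + 1 : ℕ)) : ℝ)]
        by_cases h : m₀ ≤ J x ∧ J x < m₀ + V * V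
        · simp only [w, h, true_and, if_true, and_self, clamp01_nat, hs]
          have := Nat.div_add_mod' (J x - m₀) V
          split_ifs <;> first | omega | norm_num
        · simp [w, h]
      refine mem_affSpan_of_eq e ?_
      exact sub_mem_affSpan (mem_affSpan (Or.inl ⟨v.castSucc, by simp⟩))
        (mem_affSpan (Or.inl ⟨v.succ, by simp⟩))
    · exact mem_affSpan (Or.inr ⟨u, rfl⟩)
  -- third layer: selection of the entry
  have s3 := relus (B := (Set.range fun (v : Fin V) x => w v x) ∪
    (Set.range fun (u : Fin V) x => o u x))
    (fun (v : Fin V) x => (∑ u : Fin V, y (m₀ + u * V + v) * o u x) - K * (1 - w v x))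
    (fun v => sub_mem_affSpan (affSpan_mono Set.subset_union_right (hB fun u => y (m₀ + u * V + v)))
      (mul_mem_affSpan _ (sub_mem_affSpan (const_mem_affSpan _)
        (mem_affSpan (Or.inl ⟨v, rfl⟩)))))
  have s3' := s3.mono_right
    (A' := {fun x => if m₀ ≤ J x ∧ J x < m₀ + V * V then y (J x) else 0}) ?_
  swap
  · refine Set.singleton_subset_iff.2 ?_
    have e : (fun x => if m₀ ≤ J x ∧ J x < m₀ + V * V then y (J x) else 0) = fun x =>
        ∑ v : Fin V, relu ((∑ u : Fin V, y (m₀ + u * V + v) * o u x) - K * (1 - w v x)) := by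
      ext x
      have e1 : ∀ v : Fin V,
          relu ((∑ u : Fin V, y (m₀ + u * V + v) * o u x) - K * (1 - w v x)) =
          if (m₀ ≤ J x ∧ J x < m₀ + V * V) ∧ (v : ℕ) = (J x - m₀) % V then y (J x) else 0 := by
        intro v
        rw [hsum x fun u => y (m₀ + u * V + v)]
        have hK := (hy0 0).trans (hyK 0)
        by_cases h : m₀ ≤ J x ∧ J x < m₀ + V * V
        · by_cases h' : (v : ℕ) = (J x - m₀) % V
          · have : m₀ + (J x - m₀) / V * V + v = J x := by
              have := Nat.div_add_mod' (J x - m₀) V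
              omega
            simp only [w, h, h', and_self, if_true]
            rw [← h', this]
            simp [relu, hy0]
          · simp only [w, h, h', and_self, if_true, and_false, if_false, relu]
            rw [max_eq_right]
            linarith [hyK (m₀ + (J x - m₀) / V * V + v)]
        · simp [w, h, relu, hK]
      rw [Finset.sum_congr rfl fun v _ => e1 v]
      by_cases h : m₀ ≤ J x ∧ J x < m₀ + V * V
      · simp only [h, and_self, true_and, if_true]
        rw [Fin.sum_univ_eq_sum_range (fun v => if v = (J x - m₀) % V then y (J x) else 0) V]
        simp [Nat.mod_lt _ hV]
      · simp [h]
    rw [e]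
    exact sum_mem_affSpan _ fun v _ => mem_affSpan ⟨v, rfl⟩
  simp only [Fintype.card_fin] at s1' s2' s3'
  exact ((s1'.mono_width (W' := V * 4 + 4) (by omega)).trans
    (s2'.mono_width (W' := V * 4 + 4) (by omega))).trans (s3'.mono_width (by omega))

/-- Table lookup of `β * V ^ 2` entries by a network of width `O(V)` and depth `O(β)`. -/
lemma lookup {n J : X → ℕ} {s : ℕ → ℕ} (hs : ∀ x m, s m ≤ n x ↔ m ≤ J x)
    {y : ℕ → ℝ} {K : ℝ} (hy0 : ∀ m, 0 ≤ y m) (hyK : ∀ m, y m ≤ K) {V : ℕ} (hV : 1 ≤ V) (β : ℕ)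
    (hJ : ∀ x, J x < β * (V * V)) :
    Computes (V * 4 + 8) (β * 3) {fun x => (n x : ℝ)} {fun x => y (J x)} := by
  have key : ∀ β, Computes (V * 4 + 8) (β * 3) {fun x => (n x : ℝ)}
      {fun x => (n x : ℝ), fun x => if J x < β * (V * V) then y (J x) else 0} := by
    intro β
    induction β with
    | zero =>
      rintro _ (rfl | rfl)
      · exact mem_affSpan rfl
      · simpa using const_mem_affSpan 0
    | succ β ih =>
      have h := (((lookup_block hs hy0 hyK hV (β * (V * V))).union
        (carry (fun x => (n x : ℝ)) 3)).union
        (carry (fun x => if J x < β * (V * V) then y (J x) else 0) 3)).mono_width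
        (W' := V * 4 + 8) (by omega)
      rw [add_mul, one_mul]
      refine ih.trans ((h.mono_left ?_).mono_right ?_)
      · rintro _ ((rfl | rfl) | rfl)
        all_goals exact mem_affSpan (by simp)
      · rintro _ (rfl | rfl)
        · exact mem_affSpan (by simp)
        · have e : (fun x => if J x < (β + 1) * (V * V) then y (J x) else 0) = fun x =>
              (if J x < β * (V * V) then y (J x) else 0) +
              if β * (V * V) ≤ J x ∧ J x < β * (V * V) + V * V then y (J x) else 0 := by
            ext x
            rw [add_mul β 1, one_mul]
            split_ifs <;> first | omega | simp
          rw [e]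
          exact add_mem_affSpan (mem_affSpan (by simp)) (mem_affSpan (by simp))
  refine (key β).mono_right (Set.singleton_subset_iff.2 (mem_affSpan (Or.inr ?_)))
  ext x
  simp [hJ x]

end Computes

section coding
variable (V : ℕ) (xs : ℕ → ℕ)

/-- The number of base-`V` digits of `xs i` (at least one). -/
def digLen (i : ℕ) : ℕ := Nat.log V (xs i) + 1

/-- The position at which the digits of `xs i` start, when the entries are concatenated. -/
def digPos (i : ℕ) : ℕ := ∑ j ∈ range i, digLen V xs j

/-- The index of the entry to which the digit at position `p` belongs. -/
def owner (p : ℕ) : ℕ := Nat.findGreatest (fun i => digPos V xs i ≤ p) p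

/-- The indicator that position `p` holds the last digit of an entry. -/
def endFlag (p : ℕ) : ℕ := if p + 1 = digPos V xs (owner V xs p + 1) then 1 else 0

/-- The digit at position `p`. -/
def digitAt (p : ℕ) : ℕ := xs (owner V xs p) / V ^ (digPos V xs (owner V xs p + 1) - 1 - p) % V

/-- The symbol at position `p`: a digit together with the end marker. -/
def symbolAt (p : ℕ) : ℕ := V * endFlag V xs p + digitAt V xs p

/-- The number coding the string of `L` symbols starting at position `p`. -/
def code : ℕ → ℕ → ℕ
  | _, 0 => 0
  | p, L + 1 => symbolAt V xs p * (V * 2) ^ L + code (p + 1) L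

variable {V xs}

lemma digPos_succ (i : ℕ) : digPos V xs (i + 1) = digPos V xs i + digLen V xs i :=
  Finset.sum_range_succ _ _

lemma digPos_strictMono : StrictMono (digPos V xs) :=
  strictMono_nat_of_lt_succ fun i => by rw [digPos_succ, digLen]; omega

lemma owner_spec (p : ℕ) :
    digPos V xs (owner V xs p) ≤ p ∧ p < digPos V xs (owner V xs p + 1) := by
  refine ⟨Nat.findGreatest_spec (P := fun i => digPos V xs i ≤ p) (Nat.zero_le p)
    (by simp [digPos]), ?_⟩
  by_contra! h
  have h1 : owner V xs p + 1 ≤ p := (digPos_strictMono.le_apply).trans h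
  have := Nat.le_findGreatest (P := fun i => digPos V xs i ≤ p) h1 h
  rw [← owner] at this
  omega

lemma owner_eq {p i : ℕ} (h1 : digPos V xs i ≤ p) (h2 : p < digPos V xs (i + 1)) :
    owner V xs p = i := by
  obtain ⟨h3, h4⟩ := owner_spec (V := V) (xs := xs) p
  have := digPos_strictMono.lt_iff_lt.1 (h1.trans_lt h4)
  have := digPos_strictMono.lt_iff_lt.1 (h3.trans_lt h2)
  omega

lemma owner_succ (p : ℕ) : owner V xs (p + 1) = owner V xs p + endFlag V xs p := by
  obtain ⟨h3, h4⟩ := owner_spec (V := V) (xs := xs) p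
  unfold endFlag
  split_ifs with h
  · exact owner_eq h.ge (h ▸ digPos_strictMono (Nat.lt_succ_self _))
  · exact owner_eq (by rw [add_zero]; omega) (by rw [add_zero]; omega)

lemma digitAt_lt (hV : 1 ≤ V) (p : ℕ) : digitAt V xs p < V := Nat.mod_lt _ hV

lemma symbolAt_lt (hV : 1 ≤ V) (p : ℕ) : symbolAt V xs p < V * 2 := by
  have := digitAt_lt (xs := xs) hV p
  unfold symbolAt endFlag
  split_ifs <;> omega

lemma code_lt (hV : 1 ≤ V) (p L : ℕ) : code V xs p L < (V * 2) ^ L := by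
  induction L generalizing p with
  | zero => simp [code]
  | succ L ih =>
    have h1 := ih (p + 1)
    have h2 : symbolAt V xs p + 1 ≤ V * 2 := symbolAt_lt hV p
    calc code V xs p (L + 1) = symbolAt V xs p * (V * 2) ^ L + code V xs (p + 1) L := rfl
      _ < (symbolAt V xs p + 1) * (V * 2) ^ L := by linarith
      _ ≤ (V * 2) ^ (L + 1) := by rw [pow_succ']; gcongr

lemma code_div (hV : 1 ≤ V) (p L : ℕ) :
    code V xs p (L + 1) / (V * 2) ^ L = symbolAt V xs p := by
  have h1 := code_lt (xs := xs) hV (p + 1) L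
  rw [code, Nat.add_comm, Nat.add_mul_div_right _ _ (by positivity), Nat.div_eq_of_lt h1, zero_add]

/-- The value of the digits of `xs i` located before position `p`. -/
def partialValue (V : ℕ) (xs : ℕ → ℕ) (i p : ℕ) : ℕ := xs i / V ^ (digPos V xs (i + 1) - p)

lemma partialValue_succ (hV : 2 ≤ V) (i p : ℕ) :
    partialValue V xs i (p + 1) = if owner V xs p = i
      then V * partialValue V xs i p + digitAt V xs p else partialValue V xs i p := by
  obtain ⟨h3, h4⟩ := owner_spec (V := V) (xs := xs) p
  unfold partialValue
  split_ifs with h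
  · rw [digitAt, h]
    rw [h] at h3 h4
    obtain ⟨e, he⟩ : ∃ e, digPos V xs (i + 1) = p + 1 + e := Nat.exists_eq_add_of_lt h4 |>.imp
      fun e he => by omega
    have h1 : digPos V xs (i + 1) - (p + 1) = e := by omega
    have h2 : digPos V xs (i + 1) - p = e + 1 := by omega
    have h5 : digPos V xs (i + 1) - 1 - p = e := by omega
    rw [h1, h2, h5, pow_succ, ← Nat.div_div_eq_div_mul]
    exact (Nat.div_add_mod _ _).symm
  · rcases Nat.lt_or_gt_of_ne h with h | h
    · have h6 : p + 1 ≤ digPos V xs i := h4.trans_le (digPos_strictMono.monotone h)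
      have h7 : ∀ e, digLen V xs i ≤ e → xs i / V ^ e = 0 := fun e he =>
        Nat.div_eq_of_lt ((Nat.lt_pow_succ_log_self hV _).trans_le (Nat.pow_le_pow_right (by omega) he))
      have := digPos_succ (V := V) (xs := xs) i
      rw [h7 _ (by omega), h7 _ (by omega)]
    · have h6 : digPos V xs (i + 1) ≤ p := (digPos_strictMono.monotone h).trans h3
      rw [Nat.sub_eq_zero_of_le h6, Nat.sub_eq_zero_of_le (h6.trans (Nat.le_succ p))]

lemma partialValue_le (i p : ℕ) : partialValue V xs i p ≤ xs i := Nat.div_le_self _ _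

lemma partialValue_of_le (hV : 2 ≤ V) {i p : ℕ} (h : p ≤ digPos V xs i) :
    partialValue V xs i p = 0 := by
  have := digPos_succ (V := V) (xs := xs) i
  exact Nat.div_eq_of_lt ((Nat.lt_pow_succ_log_self hV _).trans_le
    (Nat.pow_le_pow_right (by omega) (by rw [digLen] at this; omega)))

lemma partialValue_of_ge {i p : ℕ} (h : digPos V xs (i + 1) ≤ p) :
    partialValue V xs i p = xs i := by
  simp [partialValue, Nat.sub_eq_zero_of_le h]

end coding

namespace Computes
variable {X : Type}

/-- Sequential decoding of the entry `xs (n x)` from the code of a string of symbols. -/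
lemma decode {V : ℕ} (hV : 2 ≤ V) {xs : ℕ → ℕ} {M : ℕ} (hM : ∀ i, xs i ≤ M) (n : X → ℕ) (L : ℕ) :
    ∀ p : X → ℕ, Computes (V * 4 + 14) (L * 2)
      {fun x => (n x : ℝ) - owner V xs (p x), fun x => (partialValue V xs (n x) (p x) : ℝ),
        fun x => (code V xs (p x) L : ℝ)}
      {fun x => (partialValue V xs (n x) (p x + L) : ℝ)} := by
  induction L with
  | zero =>
    intro p
    exact Set.singleton_subset_iff.2 (mem_affSpan (by simp))
  | succ L ih =>
    intro p
    let c : X → ℝ := fun x => (n x : ℝ) - owner V xs (p x)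
    let a : X → ℝ := fun x => (partialValue V xs (n x) (p x) : ℝ)
    let r : X → ℝ := fun x => (code V xs (p x) (L + 1) : ℝ)
    let σ : X → ℝ := fun x => (symbolAt V xs (p x) : ℝ)
    let f : X → ℝ := fun x => (endFlag V xs (p x) : ℝ)
    let e₁ : X → ℝ := fun x => clamp01 (c x + 1)
    let e₂ : X → ℝ := fun x => clamp01 (c x)
    have hc : c ∈ affSpan {c, a, r} := mem_affSpan (by simp)
    have ha : a ∈ affSpan {c, a, r} := mem_affSpan (by simp)
    have hr : r ∈ affSpan {c, a, r} := mem_affSpan (by simp)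
    have d1 : Computes (V * 2 * 2) 1 {r} {σ} := by
      have := digit (z := r) (n := fun x => code V xs (p x) (L + 1)) (η := 1) (A := V * 2)
        (M := (V * 2) ^ L) one_pos (by omega) (by positivity) (fun x => le_rfl)
        (fun x => by simp [r]) (fun x => by rw [← pow_succ']; exact code_lt (by omega) _ _)
      simpa only [code_div (show 1 ≤ V by omega)] using this
    have hf : f = fun x => clamp01 (r x - (V * (V * 2) ^ L : ℕ) + 1) := by
      ext x
      simp only [f, r]
      have h : V * (V * 2) ^ L ≤ code V xs (p x) (L + 1) ↔
          V ≤ V * endFlag V xs (p x) + digitAt V xs (p x) := by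
        rw [← Nat.le_div_iff_mul_le (by positivity), code_div (by omega), symbolAt]
      have := digitAt_lt (V := V) (xs := xs) (by omega) (p x)
      rw [clamp01_nat]
      simp only [h]
      unfold endFlag
      split_ifs <;> first | omega | simp
    have l1 := ((((((d1.mono_left (Set.singleton_subset_iff.2 hr)).union_same
      (clamp_single (u := fun x => r x - (V * (V * 2) ^ L : ℕ) + 1)
        (add_mem_affSpan (sub_mem_affSpan hr (const_mem_affSpan _)) (const_mem_affSpan _)))).union_same
      (clamp_single (add_mem_affSpan hc (const_mem_affSpan 1)))).union_same
      (clamp_single hc)).union_same (keep hc 1)).union_same (keep ha 1)).union_same (keep hr 1)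
    rw [← hf] at l1
    let g : X → ℝ := fun x =>
      ((V : ℝ) - 1) * a x + (σ x - V * f x) - ((V : ℝ) * M + V) * (1 - (e₁ x - e₂ x))
    let c' : X → ℝ := fun x => (n x : ℝ) - owner V xs (p x + 1)
    let a' : X → ℝ := fun x => (partialValue V xs (n x) (p x + 1) : ℝ)
    let r' : X → ℝ := fun x => (code V xs (p x + 1) L : ℝ)
    have hc' : c' = fun x => c x - f x := by
      ext x
      simp only [c', c, f, owner_succ]
      push_cast
      ring
    have hr' : r' = fun x => r x - ((V * 2) ^ L : ℕ) * σ x := by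
      ext x
      simp only [r', r, σ, code]
      push_cast
      ring
    have ha' : a' = fun x => a x + relu (g x) := by
      ext x
      have e1 : e₁ x = if owner V xs (p x) ≤ n x then 1 else 0 := clamp01_nat _ _
      have e2 : e₂ x = if owner V xs (p x) + 1 ≤ n x then 1 else 0 := by
        rw [← clamp01_nat]
        simp only [e₂, c]
        push_cast
        congr 1
        ring
      have e3 : σ x - V * f x = digitAt V xs (p x) := by
        simp only [σ, f, symbolAt]
        push_cast
        ring
      have ha0 : (0 : ℝ) ≤ a x := Nat.cast_nonneg _
      have hd0 : (0 : ℝ) ≤ digitAt V xs (p x) := Nat.cast_nonneg _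
      have haM : a x ≤ M := Nat.cast_le.2 ((partialValue_le _ _).trans (hM _))
      have hdV : (digitAt V xs (p x) : ℝ) ≤ V := by exact_mod_cast (digitAt_lt (by omega) _).le
      have hV1 : (2 : ℝ) ≤ V := by exact_mod_cast hV
      simp only [a', partialValue_succ hV, g, e1, e2, e3, relu]
      split_ifs with h1 h2 h3 h3 h2 h3 h3 <;> try omega
      · rw [max_eq_left (by nlinarith)]
        push_cast
        simp only [a]
        ring
      · rw [max_eq_right (by nlinarith), add_zero]
      · rw [max_eq_right (by nlinarith), add_zero]
    have hmem : ∀ u ∈ ({σ} ∪ {f} ∪ {e₁} ∪ {e₂} ∪ {c} ∪ {a} ∪ {r} : Set (X → ℝ)),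
        u ∈ affSpan ({σ} ∪ {f} ∪ {e₁} ∪ {e₂} ∪ {c} ∪ {a} ∪ {r} : Set (X → ℝ)) :=
      fun u => mem_affSpan
    have mσ := hmem σ (by simp)
    have mf := hmem f (by simp)
    have m1 := hmem e₁ (by simp)
    have m2 := hmem e₂ (by simp)
    have mc := hmem c (by simp)
    have ma := hmem a (by simp)
    have mr := hmem r (by simp)
    have mg : g ∈ affSpan _ := sub_mem_affSpan (add_mem_affSpan (mul_mem_affSpan _ ma)
      (sub_mem_affSpan mσ (mul_mem_affSpan _ mf)))
      (mul_mem_affSpan _ (sub_mem_affSpan (const_mem_affSpan 1) (sub_mem_affSpan m1 m2)))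
    have l2 := (((relu_single mg).union_same (keep ma 1)).union_same
      (keep (mem_affSpan_of_eq hc' (sub_mem_affSpan mc mf)) 1)).union_same
      (keep (mem_affSpan_of_eq hr' (sub_mem_affSpan mr (mul_mem_affSpan _ mσ))) 1)
    have l12 := (l1.mono_width (W' := V * 4 + 14) (by omega)).trans
      (l2.mono_width (W' := V * 4 + 14) (by omega))
    have l3 := ih fun x => p x + 1
    simp only [add_assoc, add_comm 1 L] at l3
    rw [show (L + 1) * 2 = 1 + 1 + L * 2 by ring]
    refine l12.trans (l3.mono_left ?_)
    rintro _ (rfl | rfl | rfl)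
    · exact mem_affSpan (Or.inl (Or.inr rfl))
    · exact mem_affSpan_of_eq ha' (add_mem_affSpan (mem_affSpan (by simp)) (mem_affSpan (by simp)))
    · exact mem_affSpan (Or.inr rfl)

end Computes

/-- Since `log_V x ≤ T + x / V ^ T`, a bound on the sum of the entries bounds the total number of
their digits. -/
lemma digPos_le {V T N : ℕ} {xs : ℕ → ℕ} (hV : 2 ≤ V) (hT : 1 ≤ T)
    (hsum : ∑ i ∈ range N, xs i ≤ N * V ^ T) : digPos V xs N ≤ 3 * (N * T) := by
  have hVT : 0 < V ^ T := by positivity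
  have h1 : ∀ i, Nat.log V (xs i) ≤ T + xs i / V ^ T := by
    intro i
    rcases le_or_gt (Nat.log V (xs i)) T with h | h
    · exact h.trans (Nat.le_add_right _ _)
    · have h0 : xs i ≠ 0 := by
        rintro h0
        simp [h0] at h
      have h2 : V ^ Nat.log V (xs i) ≤ xs i := Nat.pow_log_le_self V h0
      obtain ⟨e, he⟩ := Nat.exists_eq_add_of_lt h
      have h3 : e + 1 < V ^ (e + 1) := Nat.lt_pow_self (by omega)
      have h4 : e + 1 ≤ xs i / V ^ T := by
        rw [Nat.le_div_iff_mul_le hVT]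
        calc (e + 1) * V ^ T ≤ V ^ (e + 1) * V ^ T := by gcongr
          _ = V ^ Nat.log V (xs i) := by rw [he, ← pow_add]; congr 1; ring
          _ ≤ xs i := h2
      omega
  have h2 : (∑ i ∈ range N, xs i / V ^ T) ≤ N := by
    have : (∑ i ∈ range N, xs i / V ^ T) * V ^ T ≤ N * V ^ T := by
      rw [Finset.sum_mul]
      exact (Finset.sum_le_sum fun i _ => Nat.div_mul_le_self _ _).trans hsum
    exact Nat.le_of_mul_le_mul_right this hVT
  calc digPos V xs N ≤ ∑ i ∈ range N, (T + xs i / V ^ T + 1) :=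
        Finset.sum_le_sum fun i _ => Nat.add_le_add_right (h1 i) 1
    _ = N * T + (∑ i ∈ range N, xs i / V ^ T) + N := by simp [Finset.sum_add_distrib]
    _ ≤ N * T + N * T + N * T := by
        have : N ≤ N * T := Nat.le_mul_of_pos_right _ hT
        omega
    _ = 3 * (N * T) := by ring

/-- Memorization of `N` nonnegative integers of average size at most `V ^ T` by a network of
width `O(V)` and depth `O(R * T + e)`. -/
lemma Computes.memorize {X : Type} {V T R N e : ℕ} {xs : ℕ → ℕ} (hV : 2 ≤ V) (hT : 1 ≤ T)
    (hR : 1 ≤ R) (hN : N ≤ V * V * (R * R * T)) (he : N ≤ V ^ e)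
    (hsum : ∑ i ∈ range N, xs i ≤ N * V ^ T) (n : X → ℕ) (hn : ∀ x, n x < N) :
    Computes (V * 8 + 18) (3 * (R * T) * 3 + (R * T + T + e + 1) * 2)
      {fun x => (n x : ℝ)} {fun x => (xs (n x) : ℝ)} := by
  wlog hM : ∀ i, xs i ≤ N * V ^ T generalizing xs
  · have h := this (xs := fun i => if i < N then xs i else 0)
      (by rwa [Finset.sum_congr rfl fun i hi => if_pos (Finset.mem_range.1 hi)]) ?_
    · simpa [hn] using h
    · intro i
      split_ifs with h
      · exact (Finset.single_le_sum (f := xs) (fun _ _ => Nat.zero_le _)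
          (Finset.mem_range.2 h)).trans hsum
      · exact Nat.zero_le _
  set G := R * T with hG
  have hG1 : 0 < G := Nat.mul_pos hR hT
  set D := G + T + e + 1 with hD
  have hex : ∀ m, ∃ i, m * G ≤ digPos V xs i := fun m => ⟨m * G, digPos_strictMono.le_apply⟩
  let s : ℕ → ℕ := fun m => Nat.find (hex m)
  let J : X → ℕ := fun x => digPos V xs (n x) / G
  have hs : ∀ x m, s m ≤ n x ↔ m ≤ J x := by
    intro x m
    rw [Nat.le_div_iff_mul_le hG1]
    refine ⟨fun h => (Nat.find_spec (hex m)).trans (digPos_strictMono.monotone h),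
      fun h => Nat.find_min' _ h⟩
  have hJ : ∀ x, J x < 3 * G * (V * V) := by
    intro x
    rw [Nat.div_lt_iff_lt_mul hG1]
    calc digPos V xs (n x) < digPos V xs N := digPos_strictMono (hn x)
      _ ≤ 3 * (N * T) := digPos_le hV hT hsum
      _ ≤ 3 * (V * V * (R * R * T) * T) := by gcongr
      _ = 3 * G * (V * V) * G := by rw [hG]; ring
  let p : X → ℕ := fun x => digPos V xs (s (J x))
  have hsJ : ∀ x, s (J x) ≤ n x := fun x => (hs x _).2 le_rfl
  have hp : ∀ x, p x ≤ digPos V xs (n x) := fun x => digPos_strictMono.monotone (hsJ x)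
  have hp2 : ∀ x, digPos V xs (n x + 1) ≤ p x + D := by
    intro x
    have h1 : J x * G ≤ p x := Nat.find_spec (hex (J x))
    have h2 : digPos V xs (n x) < J x * G + G := by
      have := Nat.lt_mul_div_succ (digPos V xs (n x)) hG1
      calc _ < _ := this
        _ = J x * G + G := by simp only [J]; ring
    have h3 : Nat.log V (xs (n x)) ≤ e + T := by
      calc Nat.log V (xs (n x)) ≤ Nat.log V (V ^ e * V ^ T) :=
            Nat.log_mono_right ((hM _).trans (Nat.mul_le_mul_right _ he))
        _ = e + T := by rw [← pow_add, Nat.log_pow (by omega)]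
    rw [digPos_succ, digLen]
    omega
  have hV1 : 1 ≤ V := by omega
  have t1 := lookup hs (y := fun m => ((min (s m) N : ℕ) : ℝ)) (K := N)
    (fun m => Nat.cast_nonneg _) (fun m => by exact_mod_cast min_le_right _ _) hV1 (3 * G) hJ
  have t2 := lookup hs (y := fun m => (code V xs (digPos V xs (s m)) D : ℝ))
    (K := ((V * 2) ^ D : ℕ)) (fun m => Nat.cast_nonneg _)
    (fun m => by exact_mod_cast (code_lt hV1 _ _).le) hV1 (3 * G) hJ
  have t := ((t1.union_same t2).union_same (carry _ _)).mono_width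
    (W' := V * 8 + 18) (by omega)
  have hd := (decode hV hM n D p).mono_width (W' := V * 8 + 18) (by omega)
  refine t.trans ((hd.mono_left ?_).mono_right ?_)
  · rintro _ (rfl | rfl | rfl)
    · refine sub_mem_affSpan (mem_affSpan (Or.inr rfl)) (mem_affSpan (Or.inl (Or.inl ?_)))
      rw [Set.mem_singleton_iff]
      ext x
      have h : owner V xs (p x) = s (J x) :=
        owner_eq le_rfl (digPos_strictMono (Nat.lt_succ_self _))
      rw [h, min_eq_left ((hsJ x).trans (hn x).le)]
    · exact mem_affSpan_of_eq (by ext x; rw [partialValue_of_le hV (hp x), Nat.cast_zero])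
        (const_mem_affSpan 0)
    · exact mem_affSpan (Or.inl (Or.inr rfl))
  · refine Set.singleton_subset_iff.2 (mem_affSpan ?_)
    rw [Set.mem_singleton_iff]
    ext x
    rw [partialValue_of_ge (hp2 x)]

/-- The sawtooth recursion `y ^ 2 = h y + (τ y) ^ 2 / n ^ 2` on `[0,1]`, where `h` and `τ` are
piecewise linear with breakpoints in `n⁻¹ ℤ`. -/
lemma sq_eq_sawtooth {n : ℕ} (hn : 1 ≤ n) {y : ℝ} (h0 : 0 ≤ y) (h1 : y ≤ 1) :
    let τ := ∑ k : Fin n, (-1 : ℝ) ^ (k : ℕ) * clamp01 (n * y - (k : ℕ))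
    0 ≤ τ ∧ τ ≤ 1 ∧
      y ^ 2 = ((∑ k : Fin n, (2 * (k : ℕ) + 1) * clamp01 (n * y - (k : ℕ))) - τ + τ ^ 2) / n ^ 2 := by
  have hn0 : (0 : ℝ) < n := by exact_mod_cast hn
  obtain ⟨m, hm, hm1, hm2⟩ : ∃ m < n, (m : ℝ) ≤ n * y ∧ n * y ≤ m + 1 := by
    by_cases h : n * y < n
    · refine ⟨⌊n * y⌋₊, (Nat.floor_lt (by positivity)).2 h, Nat.floor_le (by positivity),
        (Nat.lt_floor_add_one _).le⟩
    · have hy : n * y ≤ n := by nlinarith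
      refine ⟨n - 1, by omega, ?_, ?_⟩ <;> push_cast [hn] <;> linarith
  have key : ∀ f : ℕ → ℝ, ∑ k : Fin n, f k * clamp01 (n * y - (k : ℕ)) =
      ∑ k ∈ range m, f k + f m * (n * y - m) := by
    intro f
    rw [Fin.sum_univ_eq_sum_range (fun k => f k * clamp01 (n * y - k)) n,
      ← Finset.sum_subset (Finset.range_mono (show m + 1 ≤ n by omega)), Finset.sum_range_succ]
    · congr 1
      · refine Finset.sum_congr rfl fun k hk => ?_
        have : (k : ℝ) + 1 ≤ m := by exact_mod_cast Finset.mem_range.1 hk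
        rw [clamp01_of_one_le (by linarith), mul_one]
      · rw [clamp01_of_mem (by linarith) (by linarith)]
    · intro k _ hk
      have : (m : ℝ) + 1 ≤ k := by
        rw [Finset.mem_range] at hk
        exact_mod_cast (by omega : m + 1 ≤ k)
      rw [clamp01_of_nonpos (by linarith), mul_zero]
  have e1 : ∀ m : ℕ, ∑ k ∈ range m, (2 * (k : ℝ) + 1) = (m : ℝ) ^ 2 := by
    intro m
    induction m with
    | zero => simp
    | succ m ih => rw [Finset.sum_range_succ, ih]; push_cast; ring
  have e2 := key fun k => (-1 : ℝ) ^ k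
  have e3 := key fun k => 2 * (k : ℝ) + 1
  intro τ
  have hτ : τ = ∑ k ∈ range m, (-1 : ℝ) ^ k + (-1) ^ m * (n * y - m) := e2
  rw [e3, e1]
  clear_value τ
  rw [_root_.eq_div_iff (by positivity)]
  set u := n * y - m with hu
  have hy : n * y = m + u := by rw [hu]; ring
  have e4 : y ^ 2 * n ^ 2 = (m + u) ^ 2 := by rw [← hy]; ring
  rw [e4]
  rw [neg_one_geom_sum] at hτ
  split_ifs at hτ with hmm
  · rw [hmm.neg_one_pow] at hτ
    have : τ = u := by linarith
    rw [this]
    refine ⟨by linarith, by linarith, by ring⟩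
  · rw [(Nat.not_even_iff_odd.1 hmm).neg_one_pow] at hτ
    have : τ = 1 - u := by linarith
    rw [this]
    refine ⟨by linarith, by linarith, by ring⟩

namespace Computes
variable {X : Type}

/-- Approximation of the square function. -/
lemma square {n : ℕ} (hn : 1 ≤ n) (L : ℕ) : ∀ {y : X → ℝ} (acc : X → ℝ) (c : ℝ),
    (∀ x, 0 ≤ y x) → (∀ x, y x ≤ 1) → ∃ q : X → ℝ, (∀ x, |q x - y x ^ 2| ≤ ((1 / n ^ 2 : ℝ)) ^ L) ∧
      Computes (n * 2 + 2) L {y, acc} {fun x => acc x + c * q x} := by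
  induction L with
  | zero =>
    intro y acc c h0 h1
    refine ⟨fun _ => 0, fun x => ?_, Set.singleton_subset_iff.2 (mem_affSpan (by simp))⟩
    rw [zero_sub, abs_neg, abs_of_nonneg (sq_nonneg _), pow_zero]
    exact pow_le_one₀ (h0 x) (h1 x)
  | succ L ih =>
    intro y acc c h0 h1
    have hn0 : (0 : ℝ) < n := by exact_mod_cast hn
    have : Nonempty (Fin n) := ⟨⟨0, hn⟩⟩
    let cl : Fin n → X → ℝ := fun k x => clamp01 (n * y x - (k : ℕ))
    let τ : X → ℝ := fun x => ∑ k : Fin n, (-1 : ℝ) ^ (k : ℕ) * cl k x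
    let f : X → ℝ := fun x => ∑ k : Fin n, (2 * (k : ℕ) + 1 : ℝ) * cl k x
    let h : X → ℝ := fun x => (1 / n ^ 2 : ℝ) * (f x - τ x)
    have hsq : ∀ x, 0 ≤ τ x ∧ τ x ≤ 1 ∧ y x ^ 2 = (f x - τ x + τ x ^ 2) / n ^ 2 :=
      fun x => sq_eq_sawtooth hn (h0 x) (h1 x)
    obtain ⟨q, hq, hc⟩ := ih (y := τ) (fun x => acc x + c * h x) (c * (1 / n ^ 2))
      (fun x => (hsq x).1) (fun x => (hsq x).2.1)
    refine ⟨fun x => h x + (1 / n ^ 2) * q x, fun x => ?_, ?_⟩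
    · have e : h x + (1 / n ^ 2) * q x - y x ^ 2 = (1 / n ^ 2) * (q x - τ x ^ 2) := by
        rw [(hsq x).2.2]
        simp only [h]
        field_simp
        ring
      rw [e, abs_mul, abs_of_nonneg (by positivity : (0 : ℝ) ≤ 1 / n ^ 2), pow_succ' _ L]
      exact mul_le_mul_of_nonneg_left (hq x) (by positivity)
    · have l1 := (clamps (B := {y, acc}) (fun (k : Fin n) x => n * y x - (k : ℕ))
        (fun k => sub_mem_affSpan (mul_mem_affSpan _ (mem_affSpan (by simp)))
          (const_mem_affSpan _))).union_same (keep (u := acc) (mem_affSpan (by simp)) 1)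
      rw [Fintype.card_fin] at l1
      rw [add_comm L 1]
      have hcl : ∀ k, cl k ∈ affSpan ((Set.range fun k x => cl k x) ∪ {acc}) :=
        fun k => mem_affSpan (Or.inl ⟨k, rfl⟩)
      have hτ : τ ∈ affSpan ((Set.range fun k x => cl k x) ∪ {acc}) :=
        sum_mem_affSpan _ fun k _ => mul_mem_affSpan _ (hcl k)
      have hf : f ∈ affSpan ((Set.range fun k x => cl k x) ∪ {acc}) :=
        sum_mem_affSpan _ fun k _ => mul_mem_affSpan _ (hcl k)
      refine l1.trans ((hc.mono_left ?_).mono_right ?_)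
      · rintro _ (rfl | rfl)
        · exact hτ
        · exact add_mem_affSpan (mem_affSpan (Or.inr rfl))
            (mul_mem_affSpan _ (mul_mem_affSpan _ (sub_mem_affSpan hf hτ)))
      · refine Set.singleton_subset_iff.2 (mem_affSpan ?_)
        rw [Set.mem_singleton_iff]
        ext x
        ring

lemma relu_add_relu_neg (t : ℝ) : relu t + relu (-t) = |t| := by
  rcases le_total t 0 with h | h
  · simp [relu, max_eq_right h, max_eq_left (neg_nonneg.2 h), abs_of_nonpos h]
  · simp [relu, max_eq_left h, max_eq_right (neg_nonpos.2 h), abs_of_nonneg h]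

lemma abs_single {B : Set (X → ℝ)} {u : X → ℝ} (hu : u ∈ affSpan B) :
    Computes 2 1 B {fun x => |u x|} := by
  have h := (relu_single hu).union_same (relu_single (u := fun x => -u x)
    (Submodule.neg_mem _ hu))
  refine h.mono_right (Set.singleton_subset_iff.2 ?_)
  exact mem_affSpan_of_eq (funext fun x => (relu_add_relu_neg (u x)).symm)
    (add_mem_affSpan (mem_affSpan (by simp)) (mem_affSpan (by simp)))

/-- Approximate multiplication. -/
lemma mul {n : ℕ} (hn : 1 ≤ n) (L : ℕ) {a f : X → ℝ} (ha : ∀ x, |a x| ≤ 1) (hf0 : ∀ x, 0 ≤ f x)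
    (hf1 : ∀ x, f x ≤ 1) : ∃ m : X → ℝ, (∀ x, |m x| ≤ 1) ∧
      (∀ x, |m x - a x * f x| ≤ 2 * (1 / n ^ 2 : ℝ) ^ L) ∧
      Computes (n * 4 + 4) (L + 2) {a, f} {m} := by
  let y₁ : X → ℝ := fun x => |(1 / 2) * (a x + f x)|
  let y₂ : X → ℝ := fun x => |(1 / 2) * (a x - f x)|
  have ha' := fun x => abs_le.1 (ha x)
  obtain ⟨q₁, hq₁, c₁⟩ := square (y := y₁) hn L (fun _ => 0) 1 (fun x => abs_nonneg _)
    (fun x => abs_le.2 ⟨by linarith [ha' x, hf0 x], by linarith [ha' x, hf1 x]⟩)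
  obtain ⟨q₂, hq₂, c₂⟩ := square (y := y₂) hn L (fun _ => 0) 1 (fun x => abs_nonneg _)
    (fun x => abs_le.2 ⟨by linarith [ha' x, hf1 x], by linarith [ha' x, hf0 x]⟩)
  have hmaf : ∀ x, a x * f x = y₁ x ^ 2 - y₂ x ^ 2 := by
    intro x
    simp only [y₁, y₂, sq_abs]
    ring
  let d : X → ℝ := fun x => q₁ x - q₂ x
  have hd : ∀ x, |d x - a x * f x| ≤ 2 * (1 / n ^ 2 : ℝ) ^ L := by
    intro x
    have h1 := abs_le.1 (hq₁ x)
    have h2 := abs_le.1 (hq₂ x)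
    simp only [d]
    rw [hmaf, abs_le]
    constructor <;> linarith
  refine ⟨fun x => 2 * clamp01 ((1 / 2) * (d x + 1)) - 1, fun x => ?_, fun x => ?_, ?_⟩
  · dsimp only
    rcases le_total (d x) (-1) with h | h
    · rw [clamp01_of_nonpos (by linarith)]; norm_num
    rcases le_total (d x) 1 with h' | h'
    · rw [clamp01_of_mem (by linarith) (by linarith), abs_le]
      constructor <;> linarith
    · rw [clamp01_of_one_le (by linarith)]; norm_num
  · have h1 : |a x * f x| ≤ 1 := by
      rw [abs_mul, abs_of_nonneg (hf0 x)]
      exact mul_le_one₀ (ha x) (hf0 x) (hf1 x)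
    rw [abs_le] at h1
    refine le_trans ?_ (hd x)
    dsimp only
    rcases le_total (d x) (-1) with h | h
    · rw [clamp01_of_nonpos (by linarith), abs_of_nonpos (by linarith),
        abs_of_nonpos (by linarith)]
      linarith
    rcases le_total (d x) 1 with h' | h'
    · rw [clamp01_of_mem (by linarith) (by linarith)]
      ring_nf
      exact le_rfl
    · rw [clamp01_of_one_le (by linarith), abs_of_nonneg (by linarith),
        abs_of_nonneg (by linarith)]
      linarith
  · have ma : a ∈ affSpan {a, f} := mem_affSpan (by simp)
    have mf : f ∈ affSpan {a, f} := mem_affSpan (by simp)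
    have l1 := (abs_single (mul_mem_affSpan (1 / 2) (add_mem_affSpan ma mf))).union_same
      (abs_single (mul_mem_affSpan (1 / 2) (sub_mem_affSpan ma mf)))
    have hz : ∀ y : X → ℝ, ({y, fun _ => 0} : Set (X → ℝ)) ⊆ affSpan {y} := by
      rintro y _ (rfl | rfl)
      · exact mem_affSpan rfl
      · exact const_mem_affSpan 0
    have l2 := (c₁.mono_left (hz _)).union (c₂.mono_left (hz _))
    have md : d ∈ affSpan ({fun x => 0 + 1 * q₁ x} ∪ {fun x => 0 + 1 * q₂ x}) := by
      refine mem_affSpan_of_eq ?_ (sub_mem_affSpan (mem_affSpan (Or.inl rfl))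
        (mem_affSpan (Or.inr rfl)))
      ext x
      simp [d]
    have l3 := (clamp_single (mul_mem_affSpan (1 / 2) (add_mem_affSpan md
      (const_mem_affSpan 1)))).mono_right (A' := {fun x => 2 * clamp01 ((1 / 2) * (d x + 1)) - 1})
      (Set.singleton_subset_iff.2
        (sub_mem_affSpan (mul_mem_affSpan 2 (mem_affSpan rfl)) (const_mem_affSpan 1)))
    rw [show L + 2 = 1 + L + 1 by ring]
    exact ((l1.mono_width (by omega)).trans (l2.mono_width (by omega))).trans
      (l3.mono_width (by omega))

/-- Approximate multiplication by a finite product. -/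
lemma mul_prod {n : ℕ} (hn : 1 ≤ n) (L : ℕ) {κ ι : Type} [Fintype κ] [Nonempty κ]
    (θ : κ → X → ℝ) (F : ι → X → ℝ) (hF : ∀ i, F i ∈ affSpan (Set.range θ))
    (hF0 : ∀ i x, 0 ≤ F i x) (hF1 : ∀ i x, F i x ≤ 1) (s : Finset ι) :
    ∀ {a : X → ℝ}, (∀ x, |a x| ≤ 1) → ∃ m : X → ℝ,
      (∀ x, |m x - a x * ∏ i ∈ s, F i x| ≤ #s * (2 * (1 / n ^ 2 : ℝ) ^ L)) ∧
      Computes (n * 4 + 4 + Fintype.card κ * 2) (#s * (L + 2)) ({a} ∪ Set.range θ) {m} := by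
  classical
  induction s using Finset.induction_on with
  | empty =>
    intro a _
    refine ⟨a, fun x => by simp, ?_⟩
    rw [Finset.card_empty, zero_mul]
    exact Set.singleton_subset_iff.2 (mem_affSpan (by simp))
  | insert i s hi ih =>
    intro a ha
    obtain ⟨m₁, h1, h2, h3⟩ := mul hn L ha (hF0 i) (hF1 i)
    obtain ⟨m, h4, h5⟩ := ih h1
    refine ⟨m, fun x => ?_, ?_⟩
    · rw [Finset.prod_insert hi, Finset.card_insert_of_notMem hi]
      have hP0 : 0 ≤ ∏ i ∈ s, F i x := Finset.prod_nonneg fun i _ => hF0 i x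
      have hP1 : ∏ i ∈ s, F i x ≤ 1 := Finset.prod_le_one (fun i _ => hF0 i x) fun i _ => hF1 i x
      have e : m x - a x * (F i x * ∏ i ∈ s, F i x) = (m x - m₁ x * ∏ i ∈ s, F i x) +
          (m₁ x - a x * F i x) * ∏ i ∈ s, F i x := by ring
      rw [e]
      refine (abs_add_le _ _).trans ?_
      rw [abs_mul, abs_of_nonneg hP0]
      have := mul_le_mul (h2 x) hP1 hP0 ((abs_nonneg _).trans (h2 x))
      push_cast
      linarith [h4 x]
    · rw [Finset.card_insert_of_notMem hi, add_mul, one_mul, add_comm (#s * _)]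
      refine Computes.trans ?_ h5
      refine (h3.union (carry_range θ _)).mono_left ?_
      rintro _ ((rfl | rfl) | h)
      · exact mem_affSpan (Or.inl rfl)
      · exact affSpan_mono Set.subset_union_right (hF i)
      · exact mem_affSpan (Or.inr h)

end Computes

lemma prod_truncate {d k : ℕ} (γ : Fin d → Fin (k + 1)) (t : Fin d → ℝ) :
    ∏ i : Fin d × Fin k, (if (i.2 : ℕ) < γ i.1 then t i.1 else 1) = ∏ j, t j ^ (γ j : ℕ) := by
  rw [Fintype.prod_prod_type]
  refine Finset.prod_congr rfl fun j _ => ?_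
  have hj : (γ j : ℕ) ≤ k := Nat.lt_succ_iff.1 (γ j).2
  rw [Fin.prod_univ_eq_prod_range (fun m => if m < (γ j : ℕ) then t j else 1) k,
    ← Finset.prod_subset (Finset.range_mono hj)]
  · rw [Finset.prod_congr rfl fun m hm => if_pos (Finset.mem_range.1 hm)]
    simp
  · intro m _ hm
    rw [Finset.mem_range] at hm
    exact if_neg hm

namespace Computes
variable {X : Type}

/-- The coordinates of the cell containing a point. -/
lemma cells {d M V L₀ : ℕ} (hd : 1 ≤ d) (hV : 2 ≤ V) (hMV : M ≤ V ^ L₀) {η : ℝ} (hη : 0 < η)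
    (hη1 : η ≤ 1) {y : Fin d → X → ℝ} {i : X → Fin d → Fin M}
    (h1 : ∀ x j, (i x j : ℝ) ≤ M * y j x)
    (h2 : ∀ x j, (i x j : ℕ) + 1 < M → M * y j x ≤ (i x j : ℕ) + 1 - η) :
    Computes (d * (V * 2 + 6)) (1 + L₀) (Set.range y)
      (Set.range y ∪ Set.range fun j x => ((i x j : ℕ) : ℝ)) := by
  have : Nonempty (Fin d) := ⟨⟨0, hd⟩⟩
  have h := iUnion fun j => floor_of_good (i := fun x => (i x j : ℕ)) hV hMV hη hη1
    (fun x => (i x j).2) (fun x => h1 x j) (fun x => h2 x j)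
  rw [Fintype.card_fin, Set.iUnion_singleton_eq_range] at h
  refine h.mono_right ?_
  rintro _ (⟨j, rfl⟩ | ⟨j, rfl⟩)
  · exact mem_affSpan (Set.mem_iUnion.2 ⟨j, Or.inl rfl⟩)
  · exact mem_affSpan (Set.mem_iUnion.2 ⟨j, Or.inr rfl⟩)

/-- Memorization of nonnegative integers indexed by the cells of a grid. -/
lemma memorize_grid {d M V T R L₀ : ℕ} {xs : (Fin d → Fin M) → ℕ} (hV : 2 ≤ V) (hT : 1 ≤ T)
    (hR : 1 ≤ R) (hN : M ^ d ≤ V * V * (R * R * T)) (hMV : M ≤ V ^ L₀)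
    (hsum : ∑ i, xs i ≤ M ^ d * V ^ T) (i : X → Fin d → Fin M) :
    Computes (V * 8 + 18) (3 * (R * T) * 3 + (R * T + T + L₀ * d + 1) * 2)
      (Set.range fun j x => ((i x j : ℕ) : ℝ)) {fun x => (xs (i x) : ℝ)} := by
  let ys : ℕ → ℕ := fun n => if h : n < M ^ d then xs (finFunctionFinEquiv.symm ⟨n, h⟩) else 0
  have hys : ∀ n : Fin (M ^ d), ys n = xs (finFunctionFinEquiv.symm n) := fun n => by
    simp [ys]
  have hsum' : ∑ n ∈ range (M ^ d), ys n ≤ M ^ d * V ^ T := by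
    rw [← Fin.sum_univ_eq_sum_range, Finset.sum_congr rfl fun n _ => hys n,
      Equiv.sum_comp finFunctionFinEquiv.symm xs]
    exact hsum
  have h := memorize (e := L₀ * d) hV hT hR hN (by rw [pow_mul]; gcongr) hsum'
    (fun x => (finFunctionFinEquiv (i x) : ℕ)) (fun x => (finFunctionFinEquiv (i x)).2)
  refine (h.mono_left ?_).mono_right ?_
  · refine Set.singleton_subset_iff.2 (mem_affSpan_of_eq (g := fun x => ∑ j : Fin d,
      (M : ℝ) ^ (j : ℕ) * ((i x j : ℕ) : ℝ)) ?_ (sum_mem_affSpan _ fun j _ =>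
        mul_mem_affSpan _ (mem_affSpan ⟨j, rfl⟩)))
    ext x
    rw [finFunctionFinEquiv_apply_val]
    push_cast
    exact Finset.sum_congr rfl fun j _ => mul_comm _ _
  · refine Set.singleton_subset_iff.2 (mem_affSpan ?_)
    rw [Set.mem_singleton_iff]
    ext x
    rw [hys, Equiv.symm_apply_apply]

/-- Approximation of a monomial whose coefficient depends on the cell. -/
lemma monomial {d k M V T R L₀ n : ℕ} {xs zs : (Fin d → Fin M) → ℕ} (hd : 1 ≤ d) (hn : 1 ≤ n)
    (hnV : n ≤ V) (hV : 2 ≤ V) (hT : 1 ≤ T)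
    (hR : 1 ≤ R) (hN : M ^ d ≤ V * V * (R * R * T)) (hMV : M ≤ V ^ L₀)
    (hxs : ∑ i, xs i ≤ M ^ d * V ^ T) (hzs : ∑ i, zs i ≤ M ^ d * V ^ T) (i : X → Fin d → Fin M)
    {θ : Fin d → X → ℝ} (h0 : ∀ j x, 0 ≤ θ j x) (h1 : ∀ j x, θ j x ≤ 1) {c : ℝ}
    (hc : ∀ i, |c * ((xs i : ℝ) - zs i)| ≤ 1) (γ : Fin d → Fin (k + 1)) :
    ∃ m : X → ℝ, (∀ x, |m x - c * ((xs (i x) : ℝ) - zs (i x)) * ∏ j, θ j x ^ (γ j : ℕ)| ≤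
        (d * k) * (2 * (1 / n ^ 2 : ℝ) ^ L₀)) ∧
      Computes ((V * 8 + 18) + (V * 8 + 18) + d * 2)
        (3 * (R * T) * 3 + (R * T + T + L₀ * d + 1) * 2 + d * k * (L₀ + 2))
        ((Set.range fun j x => ((i x j : ℕ) : ℝ)) ∪ Set.range θ) {m} := by
  have : Nonempty (Fin d) := ⟨⟨0, hd⟩⟩
  let F : Fin d × Fin k → X → ℝ := fun p x => if (p.2 : ℕ) < γ p.1 then θ p.1 x else 1
  obtain ⟨m, hm, hmc⟩ := mul_prod hn L₀ θ F
    (fun p => by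
      by_cases hp : (p.2 : ℕ) < γ p.1
      · simp only [F, if_pos hp]
        exact mem_affSpan ⟨_, rfl⟩
      · simp only [F, if_neg hp]
        exact const_mem_affSpan 1)
    (fun p x => by simp only [F]; split_ifs; exacts [h0 _ _, zero_le_one])
    (fun p x => by simp only [F]; split_ifs; exacts [h1 _ _, le_rfl])
    Finset.univ (a := fun x => c * ((xs (i x) : ℝ) - zs (i x))) (fun x => hc (i x))
  have hcard : #(Finset.univ : Finset (Fin d × Fin k)) = d * k := by simp
  rw [hcard] at hmc
  refine ⟨m, fun x => ?_, ?_⟩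
  · have h := hm x
    rw [hcard, prod_truncate γ fun j => θ j x] at h
    simpa using h
  · have t := ((memorize_grid hV hT hR hN hMV hxs i).union_same
      (memorize_grid hV hT hR hN hMV hzs i)).union (carry_range θ
        (3 * (R * T) * 3 + (R * T + T + L₀ * d + 1) * 2))
    rw [Fintype.card_fin] at t hmc
    refine t.trans ((hmc.mono_left ?_).mono_width (by omega))
    rintro _ (rfl | h)
    · exact mul_mem_affSpan _ (sub_mem_affSpan (mem_affSpan (Or.inl (Or.inl rfl)))
        (mem_affSpan (Or.inl (Or.inr rfl))))
    · exact mem_affSpan (Or.inr h)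

/-- Approximation of a piecewise polynomial whose coefficients are multiples of `c`. -/
lemma piecewise {d k M V T R L₀ n : ℕ} {K : Type} [Fintype K] [Nonempty K]
    {xs zs : K → (Fin d → Fin M) → ℕ} (hd : 1 ≤ d) (hn : 1 ≤ n)
    (hnV : n ≤ V) (hV : 2 ≤ V) (hT : 1 ≤ T)
    (hR : 1 ≤ R) (hN : M ^ d ≤ V * V * (R * R * T)) (hMV : M ≤ V ^ L₀)
    (hxs : ∀ κ, ∑ i, xs κ i ≤ M ^ d * V ^ T) (hzs : ∀ κ, ∑ i, zs κ i ≤ M ^ d * V ^ T) {c : ℝ}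
    (hc : ∀ κ i, |c * ((xs κ i : ℝ) - zs κ i)| ≤ 1) (γ : K → Fin d → Fin (k + 1))
    {η : ℝ} (hη : 0 < η) (hη1 : η ≤ 1) {y : Fin d → X → ℝ} {i : X → Fin d → Fin M}
    (h1 : ∀ x j, (i x j : ℝ) ≤ M * y j x)
    (h2 : ∀ x j, (i x j : ℕ) + 1 < M → M * y j x ≤ (i x j : ℕ) + 1 - η)
    (h3 : ∀ x j, M * y j x ≤ (i x j : ℕ) + 1) (A : ℝ) :
    ∃ g ∈ NN d 1 (Fintype.card K * ((V * 8 + 18) + (V * 8 + 18) + d * 2) + d * (V * 2 + 6))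
        (1 + L₀ + (3 * (R * T) * 3 + (R * T + T + L₀ * d + 1) * 2 + d * k * (L₀ + 2))),
      ∀ x, |A * (∑ κ, c * ((xs κ (i x) : ℝ) - zs κ (i x)) *
          ∏ j, (M * y j x - (i x j : ℕ)) ^ (γ κ j : ℕ)) - g (fun j => y j x) 0| ≤
        |A| * (Fintype.card K * ((d * k) * (2 * (1 / n ^ 2 : ℝ) ^ L₀))) := by
  let θ : Fin d → X → ℝ := fun j x => M * y j x - (i x j : ℕ)
  choose m hm hmc using fun κ => monomial (xs := xs κ) (zs := zs κ) (k := k) (θ := θ) hd hn hnV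
    hV hT hR hN hMV (hxs κ) (hzs κ) i (fun j x => sub_nonneg.2 (h1 x j))
    (fun j x => sub_le_iff_le_add'.2 (h3 x j)) (hc κ) (γ κ)
  have t := ((cells hd hV hMV hη hη1 h1 h2).mono_width
    (Nat.le_add_left _ (Fintype.card K * ((V * 8 + 18) + (V * 8 + 18) + d * 2)))).trans
      (((iUnion_same hmc).mono_width (Nat.le_add_right _ (d * (V * 2 + 6)))).mono_left
      (by
        rintro _ (h | ⟨j, rfl⟩)
        · exact mem_affSpan (Or.inr h)
        · exact sub_mem_affSpan (mul_mem_affSpan _ (mem_affSpan (Or.inl ⟨j, rfl⟩)))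
            (mem_affSpan (Or.inr ⟨j, rfl⟩))))
  have t' := t.mono_right (A' := Set.range fun (_ : Fin 1) x => A * ∑ κ, m κ x) (by
    rintro _ ⟨_, rfl⟩
    exact mul_mem_affSpan _ (sum_mem_affSpan _ fun κ _ =>
      mem_affSpan (Set.mem_iUnion.2 ⟨κ, rfl⟩)))
  obtain ⟨g, hg, hgm⟩ := t'.exists_mem_NNaux
  refine ⟨g, hg, fun x => ?_⟩
  rw [← hgm, ← mul_sub, abs_mul, ← Finset.sum_sub_distrib]
  refine mul_le_mul_of_nonneg_left ?_ (abs_nonneg _)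
  refine (Finset.abs_sum_le_sum_abs _ _).trans ?_
  refine (Finset.sum_le_sum fun κ _ => (abs_sub_comm _ _).trans_le (hm κ x)).trans ?_
  simp

end Computes

lemma abs_sub_round_le {B t : ℝ} (hB : 0 < B) :
    |t - B⁻¹ * ((⌊t * B⌋₊ : ℝ) - ⌊-t * B⌋₊)| ≤ B⁻¹ := by
  have key : ∀ s : ℝ, 0 ≤ s → |s - B⁻¹ * ((⌊s * B⌋₊ : ℝ) - ⌊-s * B⌋₊)| ≤ B⁻¹ := by
    intro s hs
    rw [Nat.floor_of_nonpos (a := -s * B) (by nlinarith), Nat.cast_zero, sub_zero]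
    have h1 := Nat.floor_le (a := s * B) (by positivity)
    have h2 := Nat.lt_floor_add_one (s * B)
    have e : s - B⁻¹ * ⌊s * B⌋₊ = B⁻¹ * (s * B - ⌊s * B⌋₊) := by field_simp
    rw [e, abs_of_nonneg (mul_nonneg (by positivity) (by linarith))]
    exact mul_le_of_le_one_right (by positivity) (by linarith)
  rcases le_total 0 t with h | h
  · exact key t h
  · have := key (-t) (by linarith)
    rw [neg_neg] at this
    rw [← abs_neg]
    convert this using 2
    ring

lemma abs_round_le {B t : ℝ} (hB : 0 < B) (ht : |t| ≤ 1) :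
    |B⁻¹ * ((⌊t * B⌋₊ : ℝ) - ⌊-t * B⌋₊)| ≤ 1 := by
  have key : ∀ s : ℝ, s ≤ 1 → (⌊s * B⌋₊ : ℝ) ≤ B := by
    intro s hs
    rcases le_total 0 (s * B) with h | h
    · exact (Nat.floor_le h).trans (by nlinarith)
    · rw [Nat.floor_of_nonpos h, Nat.cast_zero]
      exact hB.le
  have h1 := key t (abs_le.1 ht).2
  have h2 := key (-t) (by linarith [(abs_le.1 ht).1])
  have h3 := Nat.cast_nonneg (α := ℝ) ⌊t * B⌋₊
  have h4 := Nat.cast_nonneg (α := ℝ) ⌊-t * B⌋₊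
  rw [abs_mul, abs_of_pos (inv_pos.2 hB), inv_mul_le_one₀ hB, abs_le]
  constructor <;> linarith

lemma coefNorm_nonneg {q : ℝ≥0∞} {ι : Type*} [Fintype ι] (v : ι → ℝ) : 0 ≤ coefNorm q v := by
  unfold coefNorm
  split_ifs
  · exact Real.iSup_nonneg fun i => abs_nonneg _
  · positivity

lemma abs_le_coefNorm {q : ℝ≥0∞} (hq : 1 ≤ q) {ι : Type*} [Fintype ι] (v : ι → ℝ) (i : ι) :
    |v i| ≤ coefNorm q v := by
  unfold coefNorm
  split_ifs with h
  · exact le_ciSup (f := fun i => |v i|) (Set.finite_range _).bddAbove i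
  · have hq0 : 0 < q.toReal := ENNReal.toReal_pos (by rintro rfl; simp at hq) h
    rw [one_div, Real.le_rpow_inv_iff_of_pos (abs_nonneg _) (by positivity) hq0]
    exact Finset.single_le_sum (f := fun i => |v i| ^ q.toReal) (fun i _ => by positivity)
      (Finset.mem_univ i)

/-- Hölder's inequality on a slice of a family of coefficients; `1 / q.toReal = 0` for `q = ∞`. -/
lemma sum_abs_le_coefNorm {q : ℝ≥0∞} (hq : 1 ≤ q) {ι κ : Type*} [Fintype ι] [Nonempty ι]
    [Fintype κ] (v : ι × κ → ℝ) (j : κ) :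
    ∑ i, |v (i, j)| ≤ (Fintype.card ι : ℝ) ^ (1 - 1 / q.toReal) * coefNorm q v := by
  by_cases h : q = ⊤
  · have := Finset.sum_le_card_nsmul Finset.univ (fun i => |v (i, j)|) (coefNorm q v)
      fun i _ => abs_le_coefNorm hq v (i, j)
    simpa [h] using this
  · have hq1 : 1 ≤ q.toReal := by
      rw [← ENNReal.toReal_one]
      exact ENNReal.toReal_mono h hq
    have hq0 : 0 < q.toReal := by linarith
    have h1 := Real.rpow_sum_le_const_mul_sum_rpow Finset.univ (fun i => v (i, j)) hq1
    have h2 : ∑ i, |v (i, j)| ^ q.toReal ≤ ∑ p, |v p| ^ q.toReal := by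
      rw [Fintype.sum_prod_type]
      exact Finset.sum_le_sum fun i _ => Finset.single_le_sum
        (f := fun j => |v (i, j)| ^ q.toReal) (fun i _ => by positivity) (Finset.mem_univ j)
    have h3 := h1.trans (mul_le_mul_of_nonneg_left h2 (by positivity))
    rw [← Real.le_rpow_inv_iff_of_pos (by positivity) (by positivity) hq0,
      Real.mul_rpow (by positivity) (by positivity), ← Real.rpow_mul (by positivity),
      Finset.card_univ, sub_mul, mul_inv_cancel₀ hq0.ne', one_mul] at h3
    rwa [coefNorm, if_neg h, one_div]

/-- The rounded multiples of the coefficients are small on average. -/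
lemma sum_floor_le {q : ℝ≥0∞} (hq : 1 ≤ q) {ι κ : Type*} [Fintype ι] [Nonempty ι]
    [Fintype κ] (v : ι × κ → ℝ) (j : κ) {B : ℝ} (hB : 0 < B) {P : ℕ}
    (hP : B ≤ P * (Fintype.card ι : ℝ) ^ (1 / q.toReal)) {r : ι → ℝ}
    (hr : ∀ i, |r i| = |v (i, j) / coefNorm q v|) :
    ∑ i, ⌊r i * B⌋₊ ≤ Fintype.card ι * P := by
  have hA := coefNorm_nonneg (q := q) v
  have hcard : (0 : ℝ) < Fintype.card ι := by exact_mod_cast Fintype.card_pos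
  have h1 : ∀ i, (⌊r i * B⌋₊ : ℝ) ≤ |v (i, j)| * (B / coefNorm q v) := by
    intro i
    have e : |v (i, j)| * (B / coefNorm q v) = |r i| * B := by
      rw [hr, abs_div, abs_of_nonneg hA]
      ring
    rw [e]
    rcases le_total 0 (r i * B) with h | h
    · exact (Nat.floor_le h).trans (mul_le_mul_of_nonneg_right (le_abs_self _) hB.le)
    · rw [Nat.floor_of_nonpos h, Nat.cast_zero]
      positivity
  have h2 : (∑ i, (⌊r i * B⌋₊ : ℝ)) ≤ Fintype.card ι * P := by
    refine (Finset.sum_le_sum fun i _ => h1 i).trans ?_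
    rw [← Finset.sum_mul]
    refine (mul_le_mul_of_nonneg_right (sum_abs_le_coefNorm hq v j) (by positivity)).trans ?_
    have e : (Fintype.card ι : ℝ) ^ (1 - 1 / q.toReal) * coefNorm q v * (B / coefNorm q v) =
        (Fintype.card ι : ℝ) ^ (1 - 1 / q.toReal) * B * (coefNorm q v / coefNorm q v) := by ring
    rw [e]
    calc _ ≤ (Fintype.card ι : ℝ) ^ (1 - 1 / q.toReal) * B :=
          mul_le_of_le_one_right (by positivity) (div_self_le_one _)
      _ ≤ (Fintype.card ι : ℝ) ^ (1 - 1 / q.toReal) *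
          (P * (Fintype.card ι : ℝ) ^ (1 / q.toReal)) := by gcongr
      _ = (Fintype.card ι : ℝ) ^ ((1 - 1 / q.toReal) + 1 / q.toReal) * P := by
          rw [Real.rpow_add hcard]; ring
      _ = Fintype.card ι * P := by rw [sub_add_cancel, Real.rpow_one]
  exact_mod_cast h2

lemma measurableSet_goodRegion (d b ℓ : ℕ) (ε : ℝ) : MeasurableSet (goodRegion d b ℓ ε) := by
  refine MeasurableSet.biUnion (Set.to_countable _) fun i _ => ?_
  refine measurableSet_setOfPred.2 (Measurable.forall fun j => ?_)
  split_ifs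
  · exact measurableSet_setOfPred.1 ((measurableSet_le measurable_const (measurable_pi_apply j)).inter
      (measurableSet_lt (measurable_pi_apply j) measurable_const))
  · exact measurableSet_setOfPred.1 ((measurableSet_le measurable_const (measurable_pi_apply j)).inter
      (measurableSet_lt (measurable_pi_apply j) measurable_const))

lemma exists_cell {d b ℓ : ℕ} (hb : 2 ≤ b) {ε : ℝ} (hε : 0 < ε) {x : Fin d → ℝ}
    (hx : x ∈ goodRegion d b ℓ ε) : ∃ i : Fin d → Fin (b ^ ℓ),
      (∀ j, ((i j : ℕ) : ℝ) ≤ (b ^ ℓ : ℕ) * x j) ∧ (∀ j, (b ^ ℓ : ℕ) * x j < (i j : ℕ) + 1) ∧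
      (∀ j, (i j : ℕ) + 1 < b ^ ℓ → (b ^ ℓ : ℕ) * x j ≤ (i j : ℕ) + 1 - (b ^ ℓ : ℕ) * ε) := by
  have hM : (0 : ℝ) < (b : ℝ) ^ ℓ := by positivity
  simp only [goodRegion, Set.mem_iUnion, Set.mem_ofPred_eq] at hx
  obtain ⟨i, hi, hx⟩ := hx
  have hxj : ∀ j, (i j : ℝ) ≤ b ^ ℓ * x j ∧ (b ^ ℓ * x j < i j + 1) ∧
      (i j + 1 < b ^ ℓ → (b : ℝ) ^ ℓ * x j ≤ i j + 1 - b ^ ℓ * ε) := by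
    intro j
    have h := hx j
    split_ifs at h with hj
    · have h1 := (div_le_iff₀' hM).1 h.1
      have h2 := (lt_div_iff₀' hM).1 (lt_sub_iff_add_lt.1 h.2)
      have := mul_pos hM hε
      exact ⟨h1, by linarith, fun _ => by linarith⟩
    · have hj' : i j + 1 = b ^ ℓ := by have := hi j; omega
      have hj'' : (i j : ℝ) = b ^ ℓ - 1 := by rw [eq_sub_iff_add_eq]; exact_mod_cast hj'
      have h1 := mul_le_mul_of_nonneg_left h.1 hM.le
      rw [mul_sub, mul_inv_cancel₀ hM.ne', mul_one] at h1
      have h2 := mul_lt_mul_of_pos_left h.2 hM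
      exact ⟨by linarith, by linarith, fun h => by omega⟩
  refine ⟨fun j => ⟨i j, hi j⟩, fun j => ?_, fun j => ?_, fun j h => ?_⟩
  · exact_mod_cast (hxj j).1
  · exact_mod_cast (hxj j).2.1
  · exact_mod_cast (hxj j).2.2 (by exact_mod_cast h)

lemma volume_goodRegion_le {d b ℓ : ℕ} (hb : 2 ≤ b) {ε : ℝ} (hε : 0 < ε) :
    volume (goodRegion d b ℓ ε) ≤ 1 := by
  have hM : (0 : ℝ) < (b ^ ℓ : ℕ) := by positivity
  have h : goodRegion d b ℓ ε ⊆ Set.pi Set.univ fun _ => Set.Ico (0 : ℝ) 1 := by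
    intro x hx j _
    obtain ⟨i, h1, h2, -⟩ := exists_cell hb hε hx
    have h3 : ((i j : ℕ) : ℝ) + 1 ≤ (b ^ ℓ : ℕ) := by exact_mod_cast (i j).2
    have h4 := h1 j
    have h5 := h2 j
    have h6 := Nat.cast_nonneg (α := ℝ) (i j : ℕ)
    exact ⟨nonneg_of_mul_nonneg_right (h6.trans h4) hM, by nlinarith⟩
  refine (measure_mono h).trans ?_
  rw [Real.volume_pi_Ico]
  simp

lemma ppoly_eq {d b ℓ k : ℕ} (hb : 2 ≤ b)
    (a : (Fin d → Fin (b ^ ℓ)) → (Fin d → Fin (k + 1)) → ℝ) {x : Fin d → ℝ}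
    {i : Fin d → Fin (b ^ ℓ)} (h1 : ∀ j, ((i j : ℕ) : ℝ) ≤ (b ^ ℓ : ℕ) * x j)
    (h2 : ∀ j, (b ^ ℓ : ℕ) * x j < (i j : ℕ) + 1) :
    ppoly d b ℓ k a x =
      ∑ γ : Γset d k, a i γ * ∏ j, ((b ^ ℓ : ℕ) * x j - (i j : ℕ)) ^ ((γ : Fin d → Fin (k + 1)) j : ℕ) := by
  have hM : (0 : ℝ) < (b : ℝ) ^ ℓ := by positivity
  have key : ∀ i' : Fin d → Fin (b ^ ℓ), x ∈ baseCell d b ℓ (fun j => (i' j : ℕ)) ↔ i' = i := by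
    intro i'
    simp only [baseCell, Set.mem_ofPred_eq, div_le_iff₀' hM, lt_div_iff₀' hM]
    push_cast at h1 h2
    constructor
    · intro h
      ext j
      have h3 : ((i' j : ℕ) : ℝ) < (i j : ℕ) + 1 := (h j).1.trans_lt (h2 j)
      have h4 : ((i j : ℕ) : ℝ) < (i' j : ℕ) + 1 := (h1 j).trans_lt (h j).2
      have h3' : (i' j : ℕ) < (i j : ℕ) + 1 := by exact_mod_cast h3
      have h4' : (i j : ℕ) < (i' j : ℕ) + 1 := by exact_mod_cast h4
      omega
    · rintro rfl j
      exact ⟨h1 j, h2 j⟩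
  unfold ppoly
  rw [Finset.sum_eq_single i]
  · rw [← Finset.sum_coe_sort]
    refine Finset.sum_congr rfl fun γ _ => ?_
    rw [rho, if_pos ((key i).2 rfl)]
    push_cast
    rfl
  · intro i' _ hi'
    refine Finset.sum_eq_zero fun γ _ => ?_
    rw [rho, if_neg (mt (key i').1 hi'), mul_zero]
  · simp

/-- The choice of the width parameter. -/
lemma exists_width {b d ℓ S T W₀ L₀ : ℕ} (hb : 2 ≤ b) (hS : 1 ≤ S) (hT : 1 ≤ T) (hW₀ : 1 ≤ W₀)
    (hL₀ : 1 ≤ L₀) {s : ℝ} {R : ℕ} (hR : (b : ℝ) ^ (-s) * S ≤ R) :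
    ∃ V : ℕ, 2 ^ W₀ ≤ V ∧ (b ^ ℓ) ^ d ≤ V * V * (R * R * T) ∧ b ^ ℓ ≤ V ^ L₀ ∧
      (b : ℝ) ^ s ≤ (V : ℝ) ^ T ∧
      (V : ℝ) ≤ 2 * max (max ((b : ℝ) ^ (s + (d : ℝ) * ℓ / 2) / (S * Real.sqrt T))
        ((b : ℝ) ^ (s / T))) (max ((b : ℝ) ^ ((ℓ : ℝ) / L₀)) ((W₀ : ℝ) * 2 ^ W₀)) := by
  set m := max (max ((b : ℝ) ^ (s + (d : ℝ) * ℓ / 2) / (S * Real.sqrt T))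
    ((b : ℝ) ^ (s / T))) (max ((b : ℝ) ^ ((ℓ : ℝ) / L₀)) ((W₀ : ℝ) * 2 ^ W₀)) with hm
  have hb0 : (0 : ℝ) < b := by positivity
  have hS0 : (0 : ℝ) < S := by positivity
  have hT0 : (0 : ℝ) < T := by positivity
  have hL0 : (0 : ℝ) < L₀ := by positivity
  have m1 : (b : ℝ) ^ (s + (d : ℝ) * ℓ / 2) / (S * Real.sqrt T) ≤ ⌈m⌉₊ :=
    ((le_max_left _ _).trans (le_max_left _ _)).trans (Nat.le_ceil m)
  have m2 : (b : ℝ) ^ (s / T) ≤ ⌈m⌉₊ :=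
    ((le_max_right _ _).trans (le_max_left _ _)).trans (Nat.le_ceil m)
  have m3 : (b : ℝ) ^ ((ℓ : ℝ) / L₀) ≤ ⌈m⌉₊ :=
    ((le_max_left _ _).trans (le_max_right _ _)).trans (Nat.le_ceil m)
  have m4 : (W₀ : ℝ) * 2 ^ W₀ ≤ m := (le_max_right _ _).trans (le_max_right _ _)
  have hW : (2 : ℝ) ^ W₀ ≤ W₀ * 2 ^ W₀ :=
    le_mul_of_one_le_left (by positivity) (by exact_mod_cast hW₀)
  have hm1 : 1 ≤ m := (one_le_pow₀ (by norm_num)).trans (hW.trans m4)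
  clear_value m
  refine ⟨⌈m⌉₊, ?_, ?_, ?_, ?_, ?_⟩
  · exact_mod_cast (hW.trans m4).trans (Nat.le_ceil m)
  · rw [div_le_iff₀ (by positivity)] at m1
    have h1 : (b : ℝ) ^ ((d : ℝ) * ℓ / 2) ≤ ⌈m⌉₊ * (R * Real.sqrt T) := by
      have e : (b : ℝ) ^ ((d : ℝ) * ℓ / 2) = b ^ (-s) * b ^ (s + (d : ℝ) * ℓ / 2) := by
        rw [← Real.rpow_add hb0]
        ring_nf
      rw [e]
      calc (b : ℝ) ^ (-s) * b ^ (s + (d : ℝ) * ℓ / 2)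
          ≤ b ^ (-s) * (⌈m⌉₊ * (S * Real.sqrt T)) := by gcongr
        _ = ⌈m⌉₊ * ((b ^ (-s) * S) * Real.sqrt T) := by ring
        _ ≤ ⌈m⌉₊ * (R * Real.sqrt T) := by gcongr
    have h2 := pow_le_pow_left₀ (by positivity) h1 2
    rw [← Real.rpow_natCast (_ ^ _), ← Real.rpow_mul hb0.le, mul_pow, mul_pow,
      Real.sq_sqrt hT0.le] at h2
    have e : (b : ℝ) ^ ((d : ℝ) * ℓ / 2 * (2 : ℕ)) = ((b ^ ℓ) ^ d : ℕ) := by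
      rw [← pow_mul]
      push_cast
      rw [← Real.rpow_natCast]
      push_cast
      congr 1
      ring
    rw [e] at h2
    have h3 : (((b ^ ℓ) ^ d : ℕ) : ℝ) ≤ (⌈m⌉₊ * ⌈m⌉₊ * (R * R * T) : ℕ) := by
      refine h2.trans (le_of_eq ?_)
      push_cast
      ring
    exact_mod_cast h3
  · have h := pow_le_pow_left₀ (by positivity) m3 L₀
    rw [← Real.rpow_natCast (_ ^ _), ← Real.rpow_mul hb0.le, div_mul_cancel₀ _ hL0.ne',
      Real.rpow_natCast] at h
    exact_mod_cast h
  · have h := pow_le_pow_left₀ (by positivity) m2 T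
    rwa [← Real.rpow_natCast (_ ^ _), ← Real.rpow_mul hb0.le, div_mul_cancel₀ _ hT0.ne'] at h
  · linarith [Nat.ceil_lt_add_one (zero_le_one.trans hm1)]

lemma inv_sq_pow_eq (W₀ L₀ : ℕ) :
    (1 / ((2 ^ W₀ : ℕ) : ℝ) ^ 2) ^ L₀ = (4 : ℝ) ^ (-((W₀ : ℝ) * L₀)) := by
  rw [Real.rpow_neg (by norm_num), ← Nat.cast_mul, Real.rpow_natCast, one_div, inv_pow]
  push_cast
  rw [← pow_mul, ← pow_mul, show (4 : ℝ) = 2 ^ 2 by norm_num, ← pow_mul]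
  congr 2
  ring

theorem pp_approx_dense (d b k : ℕ) (hd : 1 ≤ d) (hb : 2 ≤ b)
    (p q : ℝ≥0∞) (hq : 1 ≤ q) (hqp : q ≤ p) :
    ∃ C : ℝ, 0 < C ∧
      ∀ (ℓ : ℕ) (ε δ : ℝ), 0 < ε → ε < (b : ℝ) ^ (-(ℓ : ℤ)) → 0 < δ →
        ENNReal.ofReal ((d : ℝ) * ℓ) ≤ ENNReal.ofReal δ * q →
      ∀ a : (Fin d → Fin (b ^ ℓ)) → (Fin d → Fin (k + 1)) → ℝ,
      ∀ S T W₀ L₀ : ℕ, 1 ≤ S → 1 ≤ T → 1 ≤ W₀ → 1 ≤ L₀ →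
      ∃ W L : ℕ, 1 ≤ W ∧ 1 ≤ L ∧
        (W : ℝ) ≤ C * max
            (max ((b : ℝ) ^ (δ + (d : ℝ) * ℓ / 2 - (d : ℝ) * ℓ / q.toReal) /
                    ((S : ℝ) * Real.sqrt T))
                 ((b : ℝ) ^ ((δ - (d : ℝ) * ℓ / q.toReal) / T)))
            (max ((b : ℝ) ^ ((ℓ : ℝ) / L₀)) ((W₀ : ℝ) * 2 ^ W₀)) ∧
        (L : ℝ) ≤ C * ((⌈(b : ℝ) ^ (-δ + (d : ℝ) * ℓ / q.toReal) * S⌉₊ : ℝ) * T + L₀) ∧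
        ∃ g ∈ NN d 1 W L,
          eLpNorm (fun x => ppoly d b ℓ k a x - g x 0) p
              (volume.restrict (goodRegion d b ℓ ε)) ≤
            ENNReal.ofReal (C * ((b : ℝ) ^ (-δ) + (4 : ℝ) ^ (-((W₀ : ℝ) * L₀))) *
              coefNorm q (fun iγ : (Fin d → Fin (b ^ ℓ)) × (Γset d k) =>
                a iγ.1 iγ.2.1)) := by
  set K := Fintype.card (Γset d k) with hK
  have hne : Nonempty (Γset d k) := ⟨⟨0, by simp [Γset]⟩⟩
  set C₁ := 2 * ((34 + d) * K + 5 * d : ℝ) with hC₁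
  set C₂ := (17 + 2 * d + 3 * (d * k) : ℝ) with hC₂
  set C₃ := K * (1 + 2 * (d * k) : ℝ) with hC₃
  have hC₁0 : 0 ≤ C₁ := by positivity
  have hC₂0 : 0 < C₂ := by positivity
  have hC₃0 : 0 ≤ C₃ := by positivity
  clear_value C₁ C₂ C₃
  refine ⟨C₁ + C₂ + C₃, by positivity, ?_⟩
  intro ℓ ε δ hε hεb hδ hδq a S T W₀ L₀ hS hT hW₀ hL₀
  have hb0 : (0 : ℝ) < b := by positivity
  set D : ℝ := (d : ℝ) * ℓ with hD
  set s : ℝ := δ - D / q.toReal with hs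
  have hs0 : 0 ≤ s := by
    by_cases h : q = ⊤
    · simp [hs, h, hδ.le]
    · have hq0 : 0 < q.toReal := ENNReal.toReal_pos (by rintro rfl; simp at hq) h
      rw [← ENNReal.ofReal_toReal h, ← ENNReal.ofReal_mul hδ.le,
        ENNReal.ofReal_le_ofReal_iff (by positivity)] at hδq
      exact sub_nonneg.2 ((div_le_iff₀ hq0).2 hδq)
  rw [show δ + D / 2 - D / q.toReal = s + D / 2 by ring,
    show -δ + D / q.toReal = -s by ring]
  set R := ⌈(b : ℝ) ^ (-s) * S⌉₊ with hRdef
  have hR : 1 ≤ R := Nat.ceil_pos.2 (by positivity)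
  obtain ⟨V, hV1, hV2, hV3, hV4, hV5⟩ := exists_width (d := d) (ℓ := ℓ) (T := T) hb hS hT hW₀ hL₀
    (Nat.le_ceil ((b : ℝ) ^ (-s) * S))
  set mx := max (max ((b : ℝ) ^ (s + D / 2) / (S * Real.sqrt T))
        ((b : ℝ) ^ (s / T))) (max ((b : ℝ) ^ ((ℓ : ℝ) / L₀)) ((W₀ : ℝ) * 2 ^ W₀))
  clear_value mx
  have hV : 2 ≤ V := (Nat.pow_le_pow_right (by norm_num) hW₀ : 2 ^ 1 ≤ 2 ^ W₀).trans hV1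
  have hVr : (2 : ℝ) ≤ V := by exact_mod_cast hV
  set v : (Fin d → Fin (b ^ ℓ)) × Γset d k → ℝ := fun iγ => a iγ.1 iγ.2.1 with hv
  set A := coefNorm q v with hA
  have hA0 : 0 ≤ A := coefNorm_nonneg v
  have hvA : ∀ p, |v p| ≤ A := abs_le_coefNorm hq v
  set B : ℝ := (b : ℝ) ^ δ with hBdef
  have hB : 0 < B := by positivity
  rw [Real.rpow_neg hb0.le, ← hBdef]
  have : NeZero (b ^ ℓ) := ⟨by positivity⟩
  have hcard : Fintype.card (Fin d → Fin (b ^ ℓ)) = (b ^ ℓ) ^ d := by simp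
  have hP : B ≤ (V ^ T : ℕ) *
      (Fintype.card (Fin d → Fin (b ^ ℓ)) : ℝ) ^ (1 / q.toReal) := by
    have e : (Fintype.card (Fin d → Fin (b ^ ℓ)) : ℝ) ^ (1 / q.toReal) = b ^ (D / q.toReal) := by
      rw [hcard, ← pow_mul, Nat.cast_pow, ← Real.rpow_natCast, ← Real.rpow_mul hb0.le, hD]
      congr 1
      push_cast
      ring
    rw [e, hBdef, show δ = s + D / q.toReal by ring, Real.rpow_add hb0]
    push_cast
    gcongr
  have hM : (0 : ℝ) < (b ^ ℓ : ℕ) := by positivity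
  have hη1 : (b ^ ℓ : ℕ) * ε ≤ 1 := by
    rw [zpow_neg, zpow_natCast] at hεb
    push_cast
    exact (mul_le_mul_of_nonneg_left hεb.le (by positivity)).trans
      (mul_inv_le_one (a := (b : ℝ) ^ ℓ))
  choose i hi1 hi2 hi3 using fun x : goodRegion d b ℓ ε => exists_cell hb hε x.2
  obtain ⟨g, hg, hgx⟩ := Computes.piecewise (X := goodRegion d b ℓ ε) (K := Γset d k) (k := k)
    (xs := fun κ i => ⌊v (i, κ) / A * B⌋₊) (zs := fun κ i => ⌊-(v (i, κ) / A) * B⌋₊) (c := B⁻¹)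
    (y := fun j x => x.1 j) hd (Nat.one_le_two_pow (n := W₀)) hV1 hV hT hR hV2 hV3
    (fun κ => (sum_floor_le hq v κ hB hP fun i => rfl).trans_eq (by rw [hcard]))
    (fun κ => (sum_floor_le hq v κ hB hP fun i => abs_neg _).trans_eq (by rw [hcard]))
    (fun κ i => abs_round_le hB (by
      rw [abs_div, abs_of_nonneg hA0]
      exact div_le_one_of_le₀ (hvA _) hA0))
    (fun κ => κ.1) (mul_pos hM hε) hη1 hi1 hi3 (fun x j => (hi2 x j).le) A
  refine ⟨_, _, ?_, ?_, ?_, ?_, g, hg, ?_⟩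
  · have : 1 ≤ d * (V * 2 + 6) := Nat.mul_pos hd (by omega)
    exact this.trans (Nat.le_add_left _ _)
  · omega
  · have hmx : 0 ≤ mx := by linarith
    have h1 : (2 + d : ℝ) * 2 ≤ (2 + d) * V := by gcongr
    have hK0 : (0 : ℝ) ≤ K := by positivity
    have hd0 : (0 : ℝ) ≤ d := by positivity
    calc _ ≤ ((34 + d) * K + 5 * d : ℝ) * V := by
          push_cast
          rw [← hK]
          have h2 := mul_le_mul_of_nonneg_left hVr (by positivity : (0 : ℝ) ≤ K * (18 + d))
          have h3 := mul_le_mul_of_nonneg_left hVr hd0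
          linarith
      _ ≤ ((34 + d) * K + 5 * d : ℝ) * (2 * mx) := by gcongr
      _ = C₁ * mx := by rw [hC₁]; ring
      _ ≤ (C₁ + C₂ + C₃) * mx := by gcongr; linarith
  · have hRr : (1 : ℝ) ≤ R := by exact_mod_cast hR
    have hLr : (1 : ℝ) ≤ L₀ := by exact_mod_cast hL₀
    have hTr : (0 : ℝ) ≤ T := by positivity
    have hRT := mul_le_mul_of_nonneg_right hRr hTr
    have hdk : (0 : ℝ) ≤ d * k := by positivity
    have hdk' := mul_le_mul_of_nonneg_left hLr hdk
    have hRT0 : (0 : ℝ) ≤ R * T := by positivity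
    have hd0 : (0 : ℝ) ≤ d := by positivity
    calc _ ≤ C₂ * (R * T + L₀) := by
          push_cast
          rw [hC₂]
          have := mul_nonneg hd0 hRT0
          have := mul_nonneg hdk hRT0
          linarith
      _ ≤ (C₁ + C₂ + C₃) * (R * T + L₀) := by gcongr; linarith
  · set E : ℝ := (4 : ℝ) ^ (-((W₀ : ℝ) * L₀)) with hE
    have hE0 : 0 ≤ E := by positivity
    have hbound : ∀ x ∈ goodRegion d b ℓ ε,
        ‖ppoly d b ℓ k a x - g x 0‖ ≤ (C₁ + C₂ + C₃) * (B⁻¹ + E) * A := by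
      intro x hx
      have h := hgx ⟨x, hx⟩
      rw [inv_sq_pow_eq, ← hE, ← hK, abs_of_nonneg hA0] at h
      rw [Real.norm_eq_abs, ppoly_eq hb a (hi1 ⟨x, hx⟩) (hi2 ⟨x, hx⟩)]
      refine (abs_sub_le _ _ _).trans ((add_le_add ?_ h).trans
        (?_ : K * (A * B⁻¹) + A * (K * (d * k * (2 * E))) ≤ _))
      · rw [Finset.mul_sum, ← Finset.sum_sub_distrib]
        refine (Finset.abs_sum_le_sum_abs _ _).trans
          ((Finset.sum_le_card_nsmul _ _ (A * B⁻¹) fun κ _ => ?_).trans_eq (by simp [hK]))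
        have hv' : a (i ⟨x, hx⟩) κ = A * (v (i ⟨x, hx⟩, κ) / A) := by
          rcases eq_or_ne A 0 with h0 | h0
          · have := hvA (i ⟨x, hx⟩, κ)
            rw [h0] at this ⊢
            rw [zero_mul]
            exact abs_nonpos_iff.1 this
          · rw [mul_div_cancel₀ _ h0]
        rw [hv', mul_assoc A, ← mul_sub, ← sub_mul, abs_mul, abs_mul, abs_of_nonneg hA0]
        refine mul_le_mul_of_nonneg_left ?_ hA0
        refine (mul_le_of_le_one_right (abs_nonneg _) ?_).trans (abs_sub_round_le hB)
        rw [Finset.abs_prod]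
        refine Finset.prod_le_one (fun j _ => abs_nonneg _) fun j _ => ?_
        have h1 := hi1 ⟨x, hx⟩ j
        have h2 := hi2 ⟨x, hx⟩ j
        rw [abs_pow]
        exact pow_le_one₀ (abs_nonneg _) (abs_le.2 ⟨by linarith, by linarith⟩)
      · have hK0 : (0 : ℝ) ≤ K := by positivity
        have hdk : (0 : ℝ) ≤ d * k := by positivity
        calc K * (A * B⁻¹) + A * (K * (d * k * (2 * E)))
            ≤ C₃ * (B⁻¹ + E) * A := by
              rw [hC₃]
              have h1 : 0 ≤ K * A * E := by positivity
              have h2 : 0 ≤ K * A * (d * k) * B⁻¹ := by positivity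
              linarith
          _ ≤ (C₁ + C₂ + C₃) * (B⁻¹ + E) * A := by gcongr; linarith
    refine (eLpNorm_le_of_ae_bound (ae_restrict_of_forall_mem
      (measurableSet_goodRegion d b ℓ ε) hbound)).trans ?_
    rw [Measure.restrict_apply_univ]
    exact mul_le_of_le_one_left' (ENNReal.rpow_le_one (volume_goodRegion_le hb hε)
      (by positivity))
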